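/- arXiv:0803.0408 — 4 statements merged into one kernel-verified Lean document; each statement's English description precedes it below -/
import Mathlib

section
/- Let h : ℝ → ℝ be a smooth 2π-periodic function with h''(θ) + h(θ) > 0 for all θ (the support function of a smooth strictly convex closed plane curve), and let f̃ : ℝ → ℝ be a smooth 2π-periodic function. Then there exist T > 0 and a smooth function S : ℝ × [0,T) → ℝ, 2π-periodic in its first variable, such that S(θ,0) = h(θ) and S_t(θ,0) = −f̃(θ) for all θ, S_θθ(θ,t) + S(θ,t) > 0 for all (θ,t) ∈ ℝ × [0,T), and S satisfies the hyperbolic Monge–Ampère equation S·S_tt + S_tt·S_θθ − (S_θt)² + 1 = 0 on ℝ × [0,T). Moreover, any two such solutions agree on the intersection of their time intervals of existence. -/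
open Real Set Function

/-- Partial derivative in the first (angle) variable. -/
noncomputable def pdθ (S : ℝ → ℝ → ℝ) : ℝ → ℝ → ℝ := fun θ t => deriv (fun y => S y t) θ

/-- Partial derivative in the second (time) variable. -/
noncomputable def pdt (S : ℝ → ℝ → ℝ) : ℝ → ℝ → ℝ := fun θ t => deriv (fun s => S θ s) t

/-- `S` is a (smooth, `2π`-periodic in `θ`, strictly convex) solution on `ℝ × [0,T)` of the
hyperbolic Monge–Ampère initial value problem
`S·S_tt + S_tt·S_θθ − (S_θt)² + 1 = 0`, `S(θ,0) = h(θ)`, `S_t(θ,0) = −f̃(θ)`. -/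
def IsMASol (h f : ℝ → ℝ) (T : ℝ) (S : ℝ → ℝ → ℝ) : Prop :=
  ContDiff ℝ (⊤ : ℕ∞) (uncurry S) ∧
  (∀ θ t, S (θ + 2 * π) t = S θ t) ∧
  (∀ θ, S θ 0 = h θ) ∧
  (∀ θ, pdt S θ 0 = - f θ) ∧
  (∀ θ t, t ∈ Ico (0:ℝ) T →
    0 < pdθ (pdθ S) θ t + S θ t ∧
    S θ t * pdt (pdt S) θ t + pdt (pdt S) θ t * pdθ (pdθ S) θ t
      - (pdθ (pdt S) θ t) ^ 2 + 1 = 0)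

/-! ### Calculus of smooth functions of two real variables -/

/-- Joint smoothness of a curried function of two real variables. -/
def SmoothTwo (F : ℝ → ℝ → ℝ) : Prop := ContDiff ℝ (⊤ : ℕ∞) (uncurry F)

namespace SmoothTwo

variable {F : ℝ → ℝ → ℝ}

theorem hasFDerivAt (hF : SmoothTwo F) (p : ℝ × ℝ) :
    HasFDerivAt (uncurry F) (fderiv ℝ (uncurry F) p) p :=
  (ContDiff.differentiable hF (by simp) p).hasFDerivAt

theorem continuous (hF : SmoothTwo F) : Continuous (uncurry F) := ContDiff.continuous hF

theorem comp {n : WithTop ℕ∞} (hn : n ≤ (⊤ : ℕ∞)) {E : Type*} [NormedAddCommGroup E]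
    [NormedSpace ℝ E] (hF : SmoothTwo F) {a b : E → ℝ} (ha : ContDiff ℝ n a)
    (hb : ContDiff ℝ n b) : ContDiff ℝ n fun x => F (a x) (b x) :=
  (ContDiff.of_le hF hn).comp (ha.prodMk hb)

theorem pdθ_eq (hF : SmoothTwo F) (θ t : ℝ) :
    pdθ F θ t = fderiv ℝ (uncurry F) (θ, t) (1, 0) := by
  have h := (hF.hasFDerivAt (θ, t)).comp_hasDerivAt θ
    ((hasDerivAt_id θ).prodMk (hasDerivAt_const θ t))
  exact h.deriv

theorem pdt_eq (hF : SmoothTwo F) (θ t : ℝ) :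
    pdt F θ t = fderiv ℝ (uncurry F) (θ, t) (0, 1) := by
  have h := (hF.hasFDerivAt (θ, t)).comp_hasDerivAt t
    ((hasDerivAt_const t θ).prodMk (hasDerivAt_id t))
  exact h.deriv

theorem pdθ (hF : SmoothTwo F) : SmoothTwo (pdθ F) := by
  have : uncurry (_root_.pdθ F) = fun p => fderiv ℝ (uncurry F) p (1, 0) := by
    ext ⟨x, y⟩
    exact hF.pdθ_eq x y
  rw [SmoothTwo, this]
  exact (ContDiff.fderiv_right hF (m := (⊤ : ℕ∞)) (by simp)).clm_apply contDiff_const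

theorem pdt (hF : SmoothTwo F) : SmoothTwo (pdt F) := by
  have : uncurry (_root_.pdt F) = fun p => fderiv ℝ (uncurry F) p (0, 1) := by
    ext ⟨x, y⟩
    exact hF.pdt_eq x y
  rw [SmoothTwo, this]
  exact (ContDiff.fderiv_right hF (m := (⊤ : ℕ∞)) (by simp)).clm_apply contDiff_const

/-- Chain rule along a differentiable plane curve. -/
theorem hasDerivAt_comp (hF : SmoothTwo F) {a b : ℝ → ℝ} {a' b' x : ℝ} (ha : HasDerivAt a a' x)
    (hb : HasDerivAt b b' x) :
    HasDerivAt (fun s => F (a s) (b s))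
      (_root_.pdθ F (a x) (b x) * a' + _root_.pdt F (a x) (b x) * b') x := by
  have h := (hF.hasFDerivAt (a x, b x)).comp_hasDerivAt x (ha.prodMk hb)
  have e : ((a', b') : ℝ × ℝ) = a' • ((1 : ℝ), (0 : ℝ)) + b' • ((0 : ℝ), (1 : ℝ)) := by simp
  rw [e, map_add, map_smul, map_smul, ← hF.pdθ_eq, ← hF.pdt_eq, smul_eq_mul, smul_eq_mul,
    mul_comm a', mul_comm b'] at h
  exact h

theorem hasDerivAt_fst (hF : SmoothTwo F) (θ t : ℝ) :
    HasDerivAt (fun y => F y t) (_root_.pdθ F θ t) θ := by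
  simpa using hF.hasDerivAt_comp (hasDerivAt_id θ) (hasDerivAt_const θ t)

theorem hasDerivAt_snd (hF : SmoothTwo F) (θ t : ℝ) :
    HasDerivAt (fun s => F θ s) (_root_.pdt F θ t) t := by
  simpa using hF.hasDerivAt_comp (hasDerivAt_const t θ) (hasDerivAt_id t)

/-- Mixed partial derivatives commute. -/
theorem pd_comm (hF : SmoothTwo F) (θ t : ℝ) :
    _root_.pdθ (_root_.pdt F) θ t = _root_.pdt (_root_.pdθ F) θ t := by
  have h2 : DifferentiableAt ℝ (fderiv ℝ (uncurry F)) (θ, t) :=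
    (ContDiff.fderiv_right hF (m := (⊤ : ℕ∞)) (by simp)).differentiable (by simp) _
  have e1 : uncurry (_root_.pdt F) = fun p => fderiv ℝ (uncurry F) p (0, 1) := by
    ext ⟨x, y⟩
    exact hF.pdt_eq x y
  have e2 : uncurry (_root_.pdθ F) = fun p => fderiv ℝ (uncurry F) p (1, 0) := by
    ext ⟨x, y⟩
    exact hF.pdθ_eq x y
  rw [hF.pdt.pdθ_eq, hF.pdθ.pdt_eq, e1, e2]
  have d (v : ℝ × ℝ) : HasFDerivAt (fun p => fderiv ℝ (uncurry F) p v)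
      ((fderiv ℝ (fderiv ℝ (uncurry F)) (θ, t)).flip v) (θ, t) := by
    simpa using h2.hasFDerivAt.clm_apply (hasFDerivAt_const v (θ, t))
  rw [(d _).fderiv, (d _).fderiv]
  exact second_derivative_symmetric hF.hasFDerivAt h2.hasFDerivAt _ _

end SmoothTwo

theorem pdθ_periodic {F : ℝ → ℝ → ℝ} {c : ℝ} (h : ∀ θ t, F (θ + c) t = F θ t) (θ t : ℝ) :
    pdθ F (θ + c) t = pdθ F θ t := by
  unfold pdθ
  rw [← deriv_comp_add_const]
  simp only [h]

theorem pdt_periodic {F : ℝ → ℝ → ℝ} {c : ℝ} (h : ∀ θ t, F (θ + c) t = F θ t) (θ t : ℝ) :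
    pdt F (θ + c) t = pdt F θ t := by
  unfold pdt
  simp only [h]

/-- Every real number is congruent modulo `2π` to a point of `[0, 2π]`. -/
theorem exists_mem_Icc_forall_periodic (θ : ℝ) :
    ∃ y ∈ Icc (0 : ℝ) (2 * π), ∀ {α : Type} {g : ℝ → α}, Periodic g (2 * π) → g θ = g y := by
  have hp : (0 : ℝ) < 2 * π := by positivity
  refine ⟨toIcoMod hp 0 θ, Ico_subset_Icc_self (by simpa using toIcoMod_mem_Ico hp 0 θ), ?_⟩
  intro α g hg
  rw [toIcoMod]
  exact (hg.sub_zsmul_eq _).symm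

/-- A periodic function which is positive on the line `t = 0` is positive on a strip around it. -/
theorem exists_strip_pos {F : ℝ → ℝ → ℝ} (hF : Continuous (uncurry F))
    (hper : ∀ θ t, F (θ + 2 * π) t = F θ t) (h0 : ∀ θ, 0 < F θ 0) :
    ∃ T > (0 : ℝ), ∀ θ t, |t| < T → 0 < F θ t := by
  have h : ∀ᶠ t in nhds (0 : ℝ), ∀ θ ∈ Icc (0 : ℝ) (2 * π), 0 < F θ t := by
    refine isCompact_Icc.eventually_forall_of_forall_eventually fun θ _ => ?_
    have hc : Continuous fun z : ℝ × ℝ => F z.2 z.1 := hF.comp continuous_swap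
    exact hc.continuousAt.eventually (lt_mem_nhds (h0 θ))
  obtain ⟨T, hT, hb⟩ := Metric.eventually_nhds_iff.1 h
  refine ⟨T, hT, fun θ t ht => ?_⟩
  obtain ⟨y, hy, hg⟩ := exists_mem_Icc_forall_periodic θ
  rw [hg (g := fun x => F x t) fun x => hper x t]
  exact hb (by simpa using ht) y hy

/-! ### Uniqueness -/

/-- A function on `[0, t]` which is maximal at `t` has no negative derivative there. -/
theorem HasDerivAt.nonneg_of_forall_le {g : ℝ → ℝ} {d t : ℝ} (ht : 0 < t) (hg : HasDerivAt g d t)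
    (hmax : ∀ s ∈ Icc 0 t, g s ≤ g t) : 0 ≤ d := by
  have h1 : Filter.Tendsto (slope g t) (nhdsWithin t (Iio t)) (nhds d) :=
    (hasDerivAt_iff_tendsto_slope.1 hg).mono_left
      (nhdsWithin_mono _ fun x (hx : x < t) => hx.ne)
  refine ge_of_tendsto h1 ?_
  filter_upwards [Ioo_mem_nhdsLT ht] with s hs
  rw [slope_def_field]
  exact div_nonneg_of_nonpos (sub_nonpos.2 (hmax s ⟨hs.1.le, hs.2.le⟩)) (sub_nonpos.2 hs.2.le)

/-- Maximum principle for first order systems in diagonal form: periodic functions with vanishing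
initial values whose derivatives along characteristic directions are controlled by their sizes
vanish identically. -/
theorem eq_zero_of_diagonal_system {ι : Type} [Finite ι] [Nonempty ι] {w : ι → ℝ → ℝ → ℝ} {T C : ℝ}
    (hT : 0 ≤ T)
    (hper : ∀ i t, Periodic (fun θ => w i θ t) (2 * π))
    (hcont : ∀ i, ContinuousOn (uncurry (w i)) (univ ×ˢ Icc 0 T))
    (h0 : ∀ i θ, w i θ 0 = 0)
    (hder : ∀ i θ t, t ∈ Ioc 0 T → ∃ x y c, HasDerivAt (fun z => w i z t) x θ ∧
      HasDerivAt (fun s => w i θ s) y t ∧ ∀ M, (∀ j, |w j θ t| ≤ M) → |y - c * x| ≤ C * M)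
    (i : ι) (θ t : ℝ) (ht : t ∈ Icc 0 T) : w i θ t = 0 := by
  have hp : (0 : ℝ) ≤ 2 * π := by positivity
  set K := 2 * C + 1 with hK
  let g : ι → ℝ × ℝ → ℝ := fun i p => exp (-K * p.2) * (w i p.1 p.2) ^ 2
  have hgc (i) : ContinuousOn (g i) (Icc 0 (2 * π) ×ˢ Icc 0 T) := by
    refine ContinuousOn.mul (by fun_prop) (ContinuousOn.pow ?_ 2)
    exact (hcont i).mono (prod_mono_left (subset_univ _))
  have hmax (i) : ∃ p ∈ Icc (0 : ℝ) (2 * π) ×ˢ Icc 0 T,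
      IsMaxOn (g i) (Icc (0 : ℝ) (2 * π) ×ˢ Icc 0 T) p :=
    (isCompact_Icc.prod isCompact_Icc).exists_isMaxOn ⟨(0, 0), ⟨le_rfl, hp⟩, le_rfl, hT⟩ (hgc i)
  choose p hpm hpmax using hmax
  obtain ⟨i₀, hi₀⟩ := Finite.exists_max fun i => g i (p i)
  obtain ⟨⟨θ₀, t₀⟩, hp₀⟩ : ∃ z, p i₀ = z := ⟨_, rfl⟩
  have ht₀ : t₀ ∈ Icc 0 T := by
    have := (hpm i₀).2
    rwa [hp₀] at this
  have hle : ∀ j θ' t', t' ∈ Icc 0 T → g j (θ', t') ≤ g i₀ (θ₀, t₀) := by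
    intro j θ' t' ht'
    obtain ⟨y, hy, hyg⟩ := exists_mem_Icc_forall_periodic θ'
    have : g j (θ', t') = g j (y, t') := by
      simp only [g]
      rw [hyg (hper j t')]
    rw [this, ← hp₀]
    exact (hpmax j (mk_mem_prod hy ht')).trans (hi₀ j)
  have hexp : ∀ s : ℝ, 0 < exp (-K * s) := fun s => exp_pos _
  suffices hz : w i₀ θ₀ t₀ = 0 by
    have h1 := hle i θ t ht
    simp only [g, hz, ne_eq, OfNat.ofNat_ne_zero, not_false_eq_true, zero_pow, mul_zero] at h1
    have h2 : (w i θ t) ^ 2 ≤ 0 := by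
      by_contra! hlt
      have := mul_pos (hexp t) hlt
      linarith
    exact pow_eq_zero_iff two_ne_zero |>.1 (le_antisymm h2 (sq_nonneg _))
  by_contra hne
  have ht0 : 0 < t₀ := by
    rcases ht₀.1.eq_or_lt with h | h
    · exact absurd (by rw [← h]; exact h0 _ _) hne
    · exact h
  obtain ⟨x, y, c, hx, hy, hb⟩ := hder i₀ θ₀ t₀ ⟨ht0, ht₀.2⟩
  have hbd : |y - c * x| ≤ C * |w i₀ θ₀ t₀| := by
    refine hb _ fun j => sq_le_sq.1 ?_
    exact le_of_mul_le_mul_left (hle j θ₀ t₀ ht₀) (hexp t₀)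
  have hwx : w i₀ θ₀ t₀ * x = 0 := by
    have h1 : HasDerivAt (fun z => g i₀ (z, t₀)) (exp (-K * t₀) * (2 * w i₀ θ₀ t₀ * x)) θ₀ := by
      simpa [g] using (hx.fun_pow 2).const_mul (exp (-K * t₀))
    have h2 : IsLocalMax (fun z => g i₀ (z, t₀)) θ₀ :=
      Filter.Eventually.of_forall fun z => hle i₀ z t₀ ht₀
    have h3 := h2.hasDerivAt_eq_zero h1
    rcases mul_eq_zero.1 h3 with h | h
    · exact absurd h (hexp t₀).ne'
    · linarith
  have h1 : HasDerivAt (fun s => g i₀ (θ₀, s))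
      (exp (-K * t₀) * (-K) * (w i₀ θ₀ t₀) ^ 2 + exp (-K * t₀) * (2 * w i₀ θ₀ t₀ * y)) t₀ := by
    have he : HasDerivAt (fun s : ℝ => exp (-K * s)) (exp (-K * t₀) * (-K)) t₀ := by
      simpa using ((hasDerivAt_id t₀).const_mul (-K)).exp
    simpa [g] using he.fun_mul (hy.fun_pow 2)
  have h2 := h1.nonneg_of_forall_le ht0 fun s hs => hle i₀ θ₀ s ⟨hs.1, hs.2.trans ht₀.2⟩
  have h3 : w i₀ θ₀ t₀ * y ≤ C * (w i₀ θ₀ t₀) ^ 2 := by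
    have e : w i₀ θ₀ t₀ * y = w i₀ θ₀ t₀ * (y - c * x) := by linear_combination c * hwx
    rw [e, ← sq_abs (w i₀ θ₀ t₀)]
    calc _ ≤ |w i₀ θ₀ t₀ * (y - c * x)| := le_abs_self _
      _ = |w i₀ θ₀ t₀| * |y - c * x| := abs_mul _ _
      _ ≤ |w i₀ θ₀ t₀| * (C * |w i₀ θ₀ t₀|) := by gcongr
      _ = _ := by ring
  have h4 : 0 < (w i₀ θ₀ t₀) ^ 2 := by positivity
  have h5 : -K * (w i₀ θ₀ t₀) ^ 2 + 2 * (w i₀ θ₀ t₀ * y) < 0 := by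
    rw [hK]
    nlinarith
  have h6 := mul_neg_of_pos_of_neg (hexp t₀) h5
  linarith

theorem exists_bound_of_periodic {F : ℝ → ℝ → ℝ} {T : ℝ}
    (hper : ∀ t, Periodic (fun θ => F θ t) (2 * π))
    (hcont : ContinuousOn (uncurry F) (univ ×ˢ Icc 0 T)) :
    ∃ B, 0 ≤ B ∧ ∀ θ, ∀ t ∈ Icc 0 T, |F θ t| ≤ B := by
  obtain ⟨B, hB⟩ := (isCompact_Icc (a := (0 : ℝ)) (b := 2 * π)).prod
    (isCompact_Icc (a := (0 : ℝ)) (b := T)) |>.exists_bound_of_continuousOn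
    (hcont.mono (prod_mono_left (subset_univ _)))
  refine ⟨max B 0, le_max_right _ _, fun θ t ht => ?_⟩
  obtain ⟨y, hy, hyg⟩ := exists_mem_Icc_forall_periodic θ
  rw [hyg (hper t)]
  exact (hB (y, t) ⟨hy, ht⟩).trans (le_max_left _ _)

/-- The radius of curvature of the curve with support function `S`. -/
noncomputable def curvRadius (S : ℝ → ℝ → ℝ) (θ t : ℝ) : ℝ := pdθ (pdθ S) θ t + S θ t

/-- The negatives of the characteristic speeds of the Monge–Ampère equation (for `σ = ±1`), which
are also its Riemann invariants. -/
noncomputable def riemannInv (S : ℝ → ℝ → ℝ) (σ θ t : ℝ) : ℝ :=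
  (pdθ (pdt S) θ t + σ) / curvRadius S θ t

/-- The angular derivative of the Riemann invariant. -/
noncomputable def riemannInvθ (S : ℝ → ℝ → ℝ) (σ θ t : ℝ) : ℝ :=
  (pdθ (pdθ (pdt S)) θ t * curvRadius S θ t - (pdθ (pdt S) θ t + σ) * pdθ (curvRadius S) θ t) /
    curvRadius S θ t ^ 2

theorem SmoothTwo.curvRadius {S : ℝ → ℝ → ℝ} (hS : SmoothTwo S) : SmoothTwo (curvRadius S) :=
  ContDiff.add hS.pdθ.pdθ hS

section Periodic

variable {S : ℝ → ℝ → ℝ} (hper : ∀ θ t, S (θ + 2 * π) t = S θ t)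
include hper

theorem curvRadius_periodic (θ t : ℝ) : curvRadius S (θ + 2 * π) t = curvRadius S θ t := by
  simp only [curvRadius, hper, pdθ_periodic (pdθ_periodic hper)]

theorem riemannInv_periodic (σ t : ℝ) : Periodic (fun θ => riemannInv S σ θ t) (2 * π) := by
  intro θ
  simp only [riemannInv, curvRadius_periodic hper, pdθ_periodic (pdt_periodic hper)]

theorem riemannInvθ_periodic (σ t : ℝ) : Periodic (fun θ => riemannInvθ S σ θ t) (2 * π) := by
  intro θ
  simp only [riemannInvθ, curvRadius_periodic hper, pdθ_periodic (pdt_periodic hper),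
    pdθ_periodic (pdθ_periodic (pdt_periodic hper)), pdθ_periodic (curvRadius_periodic hper)]

end Periodic

/-- Evolution of the radius of curvature of a family of support functions. -/
theorem pdt_curvRadius {S : ℝ → ℝ → ℝ} (hS : SmoothTwo S) (θ t : ℝ) :
    pdt (curvRadius S) θ t = pdθ (pdθ (pdt S)) θ t + pdt S θ t := by
  have h : pdt (pdθ S) = pdθ (pdt S) := by
    ext x y
    exact (hS.pd_comm x y).symm
  rw [← h, hS.pdθ.pd_comm]
  exact ((hS.pdθ.pdθ.hasDerivAt_snd θ t).add (hS.hasDerivAt_snd θ t)).deriv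

namespace IsMASol

variable {h f : ℝ → ℝ} {T : ℝ} {S : ℝ → ℝ → ℝ} (H : IsMASol h f T S)
include H

theorem smooth : SmoothTwo S := H.1

theorem curvRadius_pos {θ t : ℝ} (ht : t ∈ Ico 0 T) : 0 < curvRadius S θ t :=
  (H.2.2.2.2 θ t ht).1

theorem pdt_pdt_eq {θ t : ℝ} (ht : t ∈ Ico 0 T) :
    pdt (pdt S) θ t = (pdθ (pdt S) θ t ^ 2 - 1) / curvRadius S θ t := by
  rw [eq_div_iff (H.curvRadius_pos ht).ne', curvRadius]
  linear_combination (H.2.2.2.2 θ t ht).2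

theorem continuousOn_riemannInv {T' : ℝ} (hT : T' < T) (σ : ℝ) :
    ContinuousOn (uncurry (riemannInv S σ)) (univ ×ˢ Icc 0 T') :=
  (H.smooth.pdt.pdθ.continuous.add continuous_const).continuousOn.div
    H.smooth.curvRadius.continuous.continuousOn
    fun p hp => (H.curvRadius_pos (θ := p.1) ⟨hp.2.1, hp.2.2.trans_lt hT⟩).ne'

theorem continuousOn_riemannInvθ {T' : ℝ} (hT : T' < T) (σ : ℝ) :
    ContinuousOn (uncurry (riemannInvθ S σ)) (univ ×ˢ Icc 0 T') :=
  ((H.smooth.pdt.pdθ.pdθ.continuous.mul H.smooth.curvRadius.continuous).sub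
      ((H.smooth.pdt.pdθ.continuous.add continuous_const).mul
        H.smooth.curvRadius.pdθ.continuous)).continuousOn.div
    (H.smooth.curvRadius.continuous.pow 2).continuousOn
    fun p hp => (pow_pos (H.curvRadius_pos (θ := p.1) ⟨hp.2.1, hp.2.2.trans_lt hT⟩) 2).ne'

theorem hasDerivAt_riemannInv_fst (σ θ : ℝ) {t : ℝ} (ht : t ∈ Ico 0 T) :
    HasDerivAt (fun y => riemannInv S σ y t) (riemannInvθ S σ θ t) θ :=
  ((H.smooth.pdt.pdθ.hasDerivAt_fst θ t).add_const σ).fun_div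
    (H.smooth.curvRadius.hasDerivAt_fst θ t) (H.curvRadius_pos ht).ne'

/-- The Riemann invariants satisfy a diagonal system. -/
theorem hasDerivAt_riemannInv_snd {σ : ℝ} (hσ : σ ^ 2 = 1) (θ : ℝ) {t : ℝ} (ht : t ∈ Ico 0 T) :
    HasDerivAt (fun s => riemannInv S σ θ s)
      (riemannInv S (-σ) θ t * riemannInvθ S σ θ t -
        riemannInv S σ θ t * pdt S θ t * (curvRadius S θ t)⁻¹) t := by
  have ha := (H.curvRadius_pos (θ := θ) ht).ne'
  have h1 : pdt (pdθ (pdt S)) θ t = (2 * pdθ (pdt S) θ t * pdθ (pdθ (pdt S)) θ t *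
      curvRadius S θ t - (pdθ (pdt S) θ t ^ 2 - 1) * pdθ (curvRadius S) θ t) /
        curvRadius S θ t ^ 2 := by
    rw [← H.smooth.pdt.pd_comm]
    have e : (fun y => pdt (pdt S) y t) =
        fun y => (pdθ (pdt S) y t ^ 2 - 1) / curvRadius S y t := by
      ext y
      exact H.pdt_pdt_eq ht
    rw [pdθ, e]
    have := (((H.smooth.pdt.pdθ.hasDerivAt_fst θ t).fun_pow 2).sub_const 1).fun_div
      (H.smooth.curvRadius.hasDerivAt_fst θ t) ha
    simpa using this.deriv
  refine (((H.smooth.pdt.pdθ.hasDerivAt_snd θ t).add_const σ).fun_div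
    (H.smooth.curvRadius.hasDerivAt_snd θ t) ha).congr_deriv ?_
  rw [h1, pdt_curvRadius H.smooth, riemannInv, riemannInv, riemannInvθ]
  field_simp
  linear_combination (-pdθ (curvRadius S) θ t) * hσ

theorem inv_curvRadius {θ t : ℝ} (ht : t ∈ Ico 0 T) :
    (curvRadius S θ t)⁻¹ = (riemannInv S 1 θ t - riemannInv S (-1) θ t) / 2 := by
  have ha := (H.curvRadius_pos (θ := θ) ht).ne'
  simp only [riemannInv]
  field_simp
  ring

theorem hasDerivAt_pdt_snd (θ : ℝ) {t : ℝ} (ht : t ∈ Ico 0 T) :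
    HasDerivAt (fun s => pdt S θ s) (riemannInv S (-1) θ t * (pdθ (pdt S) θ t + 1)) t := by
  refine (H.smooth.pdt.hasDerivAt_snd θ t).congr_deriv ?_
  rw [H.pdt_pdt_eq ht, riemannInv]
  ring

end IsMASol

/-- Two solutions of the same initial value problem have the same time derivative. -/
theorem IsMASol.pdt_eq_pdt {h f : ℝ → ℝ} {T₁ T₂ : ℝ} {S₁ S₂ : ℝ → ℝ → ℝ} (H₁ : IsMASol h f T₁ S₁)
    (H₂ : IsMASol h f T₂ S₂) {θ t : ℝ} (ht : t ∈ Ico (0 : ℝ) (min T₁ T₂)) :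
    pdt S₁ θ t = pdt S₂ θ t := by
  have ht₁ : t < T₁ := ht.2.trans_le (min_le_left _ _)
  have ht₂ : t < T₂ := ht.2.trans_le (min_le_right _ _)
  have hbdd (σ : ℝ) {S : ℝ → ℝ → ℝ} {T : ℝ} (H : IsMASol h f T S) (hT : t < T) :
      ∃ B, 0 ≤ B ∧ ∀ θ, ∀ s ∈ Icc 0 t, |riemannInv S σ θ s| ≤ B ∧ |riemannInvθ S σ θ s| ≤ B ∧
        |pdt S θ s| ≤ B ∧ |pdθ (pdt S) θ s + 1| ≤ B := by
    obtain ⟨B₁, h₁, hB₁⟩ := exists_bound_of_periodic (riemannInv_periodic H.2.1 σ)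
      (H.continuousOn_riemannInv hT σ)
    obtain ⟨B₂, h₂, hB₂⟩ := exists_bound_of_periodic (riemannInvθ_periodic H.2.1 σ)
      (H.continuousOn_riemannInvθ hT σ)
    obtain ⟨B₃, h₃, hB₃⟩ := exists_bound_of_periodic (F := pdt S) (T := t)
      (fun s θ => pdt_periodic H.2.1 θ s) H.smooth.pdt.continuous.continuousOn
    have hc : Continuous (uncurry fun θ s => pdθ (pdt S) θ s + 1) := by
      have h := H.smooth.pdt.pdθ.continuous.add (continuous_const (y := (1 : ℝ)))
      exact h
    obtain ⟨B₄, h₄, hB₄⟩ := exists_bound_of_periodic (F := fun θ s => pdθ (pdt S) θ s + 1) (T := t)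
      (fun s θ => by simp only [pdθ_periodic (pdt_periodic H.2.1)])
      hc.continuousOn
    refine ⟨B₁ + B₂ + B₃ + B₄, by positivity, fun θ s hs => ⟨?_, ?_, ?_, ?_⟩⟩
    · linarith [hB₁ θ s hs]
    · linarith [hB₂ θ s hs]
    · linarith [hB₃ θ s hs]
    · linarith [hB₄ θ s hs]
  obtain ⟨B₁, hB₁0, hB₁⟩ := hbdd 1 H₁ ht₁
  obtain ⟨B₂, hB₂0, hB₂⟩ := hbdd (-1) H₁ ht₁
  obtain ⟨B₃, hB₃0, hB₃⟩ := hbdd 1 H₂ ht₂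
  obtain ⟨B₄, hB₄0, hB₄⟩ := hbdd (-1) H₂ ht₂
  set B := B₁ + B₂ + B₃ + B₄ with hBdef
  have hB0 : 0 ≤ B := by positivity
  have hini {S : ℝ → ℝ → ℝ} {T : ℝ} (H : IsMASol h f T S) (σ θ : ℝ) :
      riemannInv S σ θ 0 = (deriv (fun y => -f y) θ + σ) / (deriv (deriv h) θ + h θ) := by
    simp only [riemannInv, curvRadius, pdθ, H.2.2.1, H.2.2.2.1]
  have hcubic {x₁ y₁ z₁ x₂ y₂ z₂ M : ℝ} (hM : 0 ≤ M) (hx : |x₁ - x₂| ≤ M) (hy : |y₁ - y₂| ≤ M)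
      (hz : |z₁ - z₂| ≤ M) (hy₁ : |y₁| ≤ B) (hz₁ : |z₁| ≤ B) (hx₂ : |x₂| ≤ B) (hy₂ : |y₂| ≤ B) :
      |x₁ * y₁ * z₁ - x₂ * y₂ * z₂| ≤ 3 * B ^ 2 * M := by
    have e : x₁ * y₁ * z₁ - x₂ * y₂ * z₂ =
        (x₁ - x₂) * y₁ * z₁ + (y₁ - y₂) * x₂ * z₁ + (z₁ - z₂) * x₂ * y₂ := by ring
    have key {a b c : ℝ} (ha : |a| ≤ M) (hb : |b| ≤ B) (hc : |c| ≤ B) :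
        |a * b * c| ≤ M * B * B := by
      rw [abs_mul, abs_mul]
      gcongr
    rw [e]
    refine (abs_add_three _ _ _).trans ?_
    linarith [key hx hy₁ hz₁, key hy hx₂ hz₁, key hz hx₂ hy₂]
  have main : ∀ i : Fin 3, ∀ θ s, s ∈ Icc 0 t →
      (![fun θ s => riemannInv S₁ 1 θ s - riemannInv S₂ 1 θ s,
        fun θ s => riemannInv S₁ (-1) θ s - riemannInv S₂ (-1) θ s,
        fun θ s => pdt S₁ θ s - pdt S₂ θ s] : Fin 3 → ℝ → ℝ → ℝ) i θ s = 0 := by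
    refine eq_zero_of_diagonal_system (C := B + 3 * B ^ 2) ht.1 ?_ ?_ ?_ ?_
    · intro i s
      fin_cases i
      · exact (riemannInv_periodic H₁.2.1 1 s).sub (riemannInv_periodic H₂.2.1 1 s)
      · exact (riemannInv_periodic H₁.2.1 (-1) s).sub (riemannInv_periodic H₂.2.1 (-1) s)
      · intro θ
        simp [pdt_periodic H₁.2.1, pdt_periodic H₂.2.1]
    · intro i
      fin_cases i
      · exact (H₁.continuousOn_riemannInv ht₁ 1).sub (H₂.continuousOn_riemannInv ht₂ 1)
      · exact (H₁.continuousOn_riemannInv ht₁ (-1)).sub (H₂.continuousOn_riemannInv ht₂ (-1))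
      · exact (H₁.smooth.pdt.continuous.sub H₂.smooth.pdt.continuous).continuousOn
    · intro i θ
      fin_cases i
      · simp [hini H₁, hini H₂]
      · simp [hini H₁, hini H₂]
      · simp [H₁.2.2.2.1, H₂.2.2.2.1]
    · intro i θ s hs
      have hs' : s ∈ Icc 0 t := ⟨hs.1.le, hs.2⟩
      have hs₁ : s ∈ Ico 0 T₁ := ⟨hs.1.le, hs.2.trans_lt ht₁⟩
      have hs₂ : s ∈ Ico 0 T₂ := ⟨hs.1.le, hs.2.trans_lt ht₂⟩
      obtain ⟨p₁, -, q₁, -⟩ := hB₁ θ s hs'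
      obtain ⟨m₁, -, -, -⟩ := hB₂ θ s hs'
      obtain ⟨p₂, pθ₂, q₂, qθ₂⟩ := hB₃ θ s hs'
      obtain ⟨m₂, mθ₂, -, -⟩ := hB₄ θ s hs'
      have k₁ : |(curvRadius S₁ θ s)⁻¹| ≤ B := by
        rw [H₁.inv_curvRadius hs₁, abs_div, abs_two]
        linarith [abs_sub (riemannInv S₁ 1 θ s) (riemannInv S₁ (-1) θ s)]
      have kd {M : ℝ} (h0 : |riemannInv S₁ 1 θ s - riemannInv S₂ 1 θ s| ≤ M)
          (h1 : |riemannInv S₁ (-1) θ s - riemannInv S₂ (-1) θ s| ≤ M) :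
          |(curvRadius S₁ θ s)⁻¹ - (curvRadius S₂ θ s)⁻¹| ≤ M := by
        rw [H₁.inv_curvRadius hs₁, H₂.inv_curvRadius hs₂]
        rw [abs_le] at *
        constructor <;> linarith [h0.1, h0.2, h1.1, h1.2]
      have hlin {a b M : ℝ} (ha : |a| ≤ M) (hb : |b| ≤ B) : |a * b| ≤ B * M := by
        rw [abs_mul, mul_comm]
        gcongr
      fin_cases i
      · refine ⟨_, _, riemannInv S₁ (-1) θ s, (H₁.hasDerivAt_riemannInv_fst 1 θ hs₁).sub
          (H₂.hasDerivAt_riemannInv_fst 1 θ hs₂),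
          (H₁.hasDerivAt_riemannInv_snd (by norm_num) θ hs₁).sub
          (H₂.hasDerivAt_riemannInv_snd (by norm_num) θ hs₂), fun M hM => ?_⟩
        have h0 : |riemannInv S₁ 1 θ s - riemannInv S₂ 1 θ s| ≤ M := hM 0
        have h1 : |riemannInv S₁ (-1) θ s - riemannInv S₂ (-1) θ s| ≤ M := hM 1
        have h2 : |pdt S₁ θ s - pdt S₂ θ s| ≤ M := hM 2
        have c1 := hcubic ((abs_nonneg _).trans h0) h0 h2 (kd h0 h1) (by linarith) k₁
          (by linarith) (show |pdt S₂ θ s| ≤ B by linarith)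
        have c2 := hlin h1 (show |riemannInvθ S₂ 1 θ s| ≤ B by linarith)
        rw [abs_le] at c1 c2 ⊢
        constructor <;> linarith [c1.1, c1.2, c2.1, c2.2]
      · have hd₁ := H₁.hasDerivAt_riemannInv_snd (σ := -1) (by norm_num) θ hs₁
        have hd₂ := H₂.hasDerivAt_riemannInv_snd (σ := -1) (by norm_num) θ hs₂
        rw [neg_neg] at hd₁ hd₂
        refine ⟨_, _, riemannInv S₁ 1 θ s, (H₁.hasDerivAt_riemannInv_fst (-1) θ hs₁).sub
          (H₂.hasDerivAt_riemannInv_fst (-1) θ hs₂), hd₁.sub hd₂, fun M hM => ?_⟩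
        have h0 : |riemannInv S₁ 1 θ s - riemannInv S₂ 1 θ s| ≤ M := hM 0
        have h1 : |riemannInv S₁ (-1) θ s - riemannInv S₂ (-1) θ s| ≤ M := hM 1
        have h2 : |pdt S₁ θ s - pdt S₂ θ s| ≤ M := hM 2
        have c1 := hcubic ((abs_nonneg _).trans h0) h1 h2 (kd h0 h1) (by linarith) k₁
          (by linarith) (show |pdt S₂ θ s| ≤ B by linarith)
        have c2 := hlin h0 (show |riemannInvθ S₂ (-1) θ s| ≤ B by linarith)
        rw [abs_le] at c1 c2 ⊢
        constructor <;> linarith [c1.1, c1.2, c2.1, c2.2]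
      · refine ⟨_, _, riemannInv S₁ (-1) θ s, (H₁.smooth.pdt.hasDerivAt_fst θ s).sub
          (H₂.smooth.pdt.hasDerivAt_fst θ s), (H₁.hasDerivAt_pdt_snd θ hs₁).sub
          (H₂.hasDerivAt_pdt_snd θ hs₂), fun M hM => ?_⟩
        have h1 : |riemannInv S₁ (-1) θ s - riemannInv S₂ (-1) θ s| ≤ M := hM 1
        have hM0 : 0 ≤ M := (abs_nonneg _).trans h1
        have c2 := hlin h1 (show |pdθ (pdt S₂) θ s + 1| ≤ B by linarith)
        have c3 : 0 ≤ 3 * B ^ 2 * M := by positivity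
        rw [abs_le] at c2 ⊢
        constructor <;> linarith [c2.1, c2.2]
  have := main 2 θ t ⟨ht.1, le_rfl⟩
  exact sub_eq_zero.1 (by simpa using this)

/-- Uniqueness for the initial value problem. -/
theorem IsMASol.unique {h f : ℝ → ℝ} {T₁ T₂ : ℝ} {S₁ S₂ : ℝ → ℝ → ℝ} (H₁ : IsMASol h f T₁ S₁)
    (H₂ : IsMASol h f T₂ S₂) {θ t : ℝ} (ht : t ∈ Ico (0 : ℝ) (min T₁ T₂)) : S₁ θ t = S₂ θ t := by
  have hd (s : ℝ) : HasDerivAt (fun s => S₁ θ s - S₂ θ s) (pdt S₁ θ s - pdt S₂ θ s) s :=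
    (H₁.smooth.hasDerivAt_snd θ s).sub (H₂.smooth.hasDerivAt_snd θ s)
  have := constant_of_has_deriv_right_zero (f := fun s => S₁ θ s - S₂ θ s) (a := 0) (b := t)
    (fun s _ => (hd s).continuousAt.continuousWithinAt)
    (fun s hs => by
      have := (hd s).hasDerivWithinAt (s := Ici s)
      rwa [H₁.pdt_eq_pdt H₂ ⟨hs.1, hs.2.trans ht.2⟩, sub_self] at this) t ⟨ht.1, le_rfl⟩
  simp only [H₁.2.2.1, H₂.2.2.1, sub_self] at this
  exact sub_eq_zero.1 this

/-! ### Smooth families of continuous functions -/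

/-- The family of functions `k ↦ G (x, i k)` on a compact space, as a function of `x`. -/
def sliceMap {E P F K : Type} [TopologicalSpace E] [TopologicalSpace P] [TopologicalSpace F]
    [TopologicalSpace K] (i : C(K, P)) (G : C(E × P, F)) : C(E, C(K, F)) :=
  (G.comp ((ContinuousMap.id E).prodMap i)).curry

@[simp]
theorem sliceMap_apply {E P F K : Type} [TopologicalSpace E] [TopologicalSpace P]
    [TopologicalSpace F] [TopologicalSpace K] (i : C(K, P)) (G : C(E × P, F)) (x : E) (k : K) :
    sliceMap i G x k = G (x, i k) := rfl

section Slice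

variable {E F K : Type} [NormedAddCommGroup E] [NormedSpace ℝ E] [NormedAddCommGroup F]
  [NormedSpace ℝ F] [TopologicalSpace K] [CompactSpace K]

/-- A continuous family of continuous linear maps is a continuous linear map into families. -/
noncomputable def familyToCLM : C(K, E →L[ℝ] F) →L[ℝ] E →L[ℝ] C(K, F) :=
  LinearMap.mkContinuous₂
    (LinearMap.mk₂ ℝ (fun (φ : C(K, E →L[ℝ] F)) (e : E) =>
        (⟨fun k => φ k e, by fun_prop⟩ : C(K, F)))
      (fun _ _ _ => by ext; simp) (fun _ _ _ => by ext; simp)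
      (fun _ _ _ => by ext; simp) (fun _ _ _ => by ext; simp)) 1 fun φ e => by
    rw [ContinuousMap.norm_le _ (by positivity)]
    intro k
    rw [one_mul]
    exact (φ k).le_of_opNorm_le (φ.norm_coe_le_norm k) e

theorem hasFDerivAt_sliceMap {P : Type} [TopologicalSpace P] (i : C(K, P))
    (G : C(E × P, F)) (D : C(E × P, E →L[ℝ] F))
    (hD : ∀ x p, HasFDerivAt (fun y => G (y, p)) (D (x, p)) x) (x : E) :
    HasFDerivAt (sliceMap i G) (familyToCLM (sliceMap i D x)) x := by
  rw [hasFDerivAt_iff_isLittleO, Asymptotics.isLittleO_iff]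
  intro c hc
  obtain ⟨δ, hδ, hb⟩ :=
    (Metric.continuous_iff (β := C(K, E →L[ℝ] F))).1 (sliceMap i D).continuous x c hc
  filter_upwards [Metric.ball_mem_nhds x hδ] with y hy
  rw [ContinuousMap.norm_le _ (by positivity)]
  intro k
  have := (convex_ball x δ).norm_image_sub_le_of_norm_hasFDerivWithin_le'
    (f := fun y => G (y, i k)) (f' := fun y => D (y, i k)) (φ := D (x, i k)) (C := c)
    (fun z _ => (hD z (i k)).hasFDerivWithinAt)
    (fun z hz => by
      have h := ((sliceMap i D z - sliceMap i D x).norm_coe_le_norm k).trans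
        (dist_eq_norm (sliceMap i D z) _ ▸ (hb z hz).le)
      simpa using h)
    (Metric.mem_ball_self hδ) hy
  simpa [familyToCLM] using this

variable {P : Type} [NormedAddCommGroup P] [NormedSpace ℝ P]

theorem contDiff_sliceMap_nat (i : C(K, P)) (n : ℕ) :
    ∀ (F : Type) [NormedAddCommGroup F] [NormedSpace ℝ F] (G : C(E × P, F)),
      ContDiff ℝ n G → ContDiff ℝ n (sliceMap i G) := by
  induction n with
  | zero =>
    intro F _ _ G _
    exact contDiff_zero.2 (sliceMap i G).continuous
  | succ n ih =>
    intro F _ _ G hG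
    have hD : ContDiff ℝ n fun p : E × P =>
        (fderiv ℝ G p).comp (ContinuousLinearMap.inl ℝ E P) :=
      (hG.fderiv_right (m := n) (by simp)).clm_comp contDiff_const
    let D : C(E × P, E →L[ℝ] F) := ⟨_, hD.continuous⟩
    push_cast
    rw [contDiff_succ_iff_hasFDerivAt]
    refine ⟨fun x => familyToCLM (sliceMap i D x),
      ContDiff.comp (g := familyToCLM (K := K) (E := E) (F := F))
        (ContinuousLinearMap.contDiff _) (ih _ D hD),
      hasFDerivAt_sliceMap i G D fun x p => ?_⟩
    have h1 : HasFDerivAt G (fderiv ℝ G (x, p)) (x, p) :=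
      (hG.differentiable (by simp) _).hasFDerivAt
    have h2 : HasFDerivAt (fun y : E => (y, p)) (ContinuousLinearMap.inl ℝ E P) x :=
      hasFDerivAt_prodMk_left x p
    exact h1.comp x h2

/-- A jointly smooth function defines a smooth family of continuous functions. -/
theorem contDiff_sliceMap (i : C(K, P)) (G : C(E × P, F)) (hG : ContDiff ℝ (⊤ : ℕ∞) G) :
    ContDiff ℝ (⊤ : ℕ∞) (sliceMap i G) :=
  contDiff_infty.2 fun n => contDiff_sliceMap_nat i n F G (hG.of_le (mod_cast le_top))

end Slice

/-- Integrals over `[0, 1]` of smooth functions depend smoothly on parameters. -/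
theorem contDiff_integral_unit {E : Type} [NormedAddCommGroup E] [NormedSpace ℝ E]
    {G : E × ℝ → ℝ} (hG : ContDiff ℝ (⊤ : ℕ∞) G) :
    ContDiff ℝ (⊤ : ℕ∞) fun x => ∫ s in (0 : ℝ)..1, G (x, s) := by
  let L : C(Icc (0 : ℝ) 1, ℝ) →L[ℝ] ℝ := LinearMap.mkContinuous
    { toFun := fun φ => ∫ s in (0 : ℝ)..1, φ (projIcc 0 1 zero_le_one s)
      map_add' := fun φ ψ => intervalIntegral.integral_add
        ((φ.continuous.comp continuous_projIcc).intervalIntegrable _ _)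
        ((ψ.continuous.comp continuous_projIcc).intervalIntegrable _ _)
      map_smul' := fun c φ => by simp } 1 fun φ => by
    have := intervalIntegral.norm_integral_le_of_norm_le_const (a := (0 : ℝ)) (b := 1)
      (f := fun s => φ (projIcc 0 1 zero_le_one s)) fun s _ => φ.norm_coe_le_norm _
    simpa using this
  have h := L.contDiff.comp
    (contDiff_sliceMap (⟨Subtype.val, continuous_subtype_val⟩ : C(Icc (0 : ℝ) 1, ℝ))
      ⟨G, hG.continuous⟩ hG)
  convert h using 2 with x
  refine intervalIntegral.integral_congr fun s hs => ?_
  rw [uIcc_of_le zero_le_one] at hs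
  simp [projIcc_of_mem zero_le_one hs]

/-- Primitives of smooth functions of two variables, with a variable base point, are smooth. -/
theorem SmoothTwo.contDiff_primitive {E : Type} [NormedAddCommGroup E] [NormedSpace ℝ E]
    {G : E → ℝ → ℝ} (hG : ContDiff ℝ (⊤ : ℕ∞) (uncurry G)) {a b : E → ℝ}
    (ha : ContDiff ℝ (⊤ : ℕ∞) a) (hb : ContDiff ℝ (⊤ : ℕ∞) b) :
    ContDiff ℝ (⊤ : ℕ∞) fun x => ∫ s in a x..b x, G x s := by
  have h (x : E) : ∫ s in a x..b x, G x s =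
      (b x - a x) * ∫ s in (0 : ℝ)..1, G x (a x + (b x - a x) * s) := by
    have := intervalIntegral.smul_integral_comp_add_mul (a := 0) (b := 1) (G x) (b x - a x) (a x)
    rw [smul_eq_mul] at this
    rw [this]
    congr 1 <;> ring
  simp only [h]
  refine (hb.sub ha).mul (contDiff_integral_unit
    (G := fun p : E × ℝ => G p.1 (a p.1 + (b p.1 - a p.1) * p.2)) ?_)
  exact hG.comp (contDiff_fst.prodMk
    ((ha.comp contDiff_fst).add (((hb.sub ha).comp contDiff_fst).mul contDiff_snd)))

/-! ### Resolvents of smooth families of operators -/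

theorem continuous_norm_comp {X Y : Type} [NormedAddCommGroup X] [NormedSpace ℝ X]
    [TopologicalSpace Y] {T : Y → X →L[ℝ] X} (hT : Continuous T) :
    Continuous fun x => ‖T x‖ := hT.norm

section Resolvent

variable {X E : Type} [NormedAddCommGroup X] [NormedSpace ℝ X] [NormedAddCommGroup E]
  [NormedSpace ℝ E]

theorem contDiff_smul_comp_add {n : WithTop ℕ∞} (M : X →L[ℝ] X →L[ℝ] X) (V W : X →L[ℝ] X)
    {c : E → ℝ} {a b : E → X} (hc : ContDiff ℝ n c) (ha : ContDiff ℝ n a)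
    (hb : ContDiff ℝ n b) :
    ContDiff ℝ n fun x => c x • ((M (a x)).comp V + (M (b x)).comp W) :=
  hc.smul (((M.contDiff.comp ha).clm_comp contDiff_const).add
    ((M.contDiff.comp hb).clm_comp contDiff_const))

theorem norm_zero_smul_lt_one {c : ℝ} (hc : c = 0) (T : X →L[ℝ] X) : ‖c • T‖ < 1 := by
  simp [hc]

theorem contDiffAt_clm_comp {n : WithTop ℕ∞} (L : X →L[ℝ] ℝ) {g : E → X} {x : E}
    (hg : ContDiffAt ℝ n g x) : ContDiffAt ℝ n (fun x => L (g x)) x :=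
  L.contDiff.contDiffAt.comp x hg

variable [CompleteSpace X]

theorem isUnit_one_sub_of_norm_lt {T : X →L[ℝ] X} (hT : ‖T‖ < 1) : IsUnit (1 - T) :=
  (Units.oneSub T hT).isUnit

theorem contDiffAt_inverse_one_sub_apply {n : WithTop ℕ∞} {T : E → X →L[ℝ] X} {g : E → X}
    (hT : ContDiff ℝ n T) (hg : ContDiff ℝ n g) {x : E} (hx : ‖T x‖ < 1) :
    ContDiffAt ℝ n (fun x => Ring.inverse (1 - T x) (g x)) x := by
  have h : ContDiffAt ℝ n Ring.inverse (1 - T x) :=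
    contDiffAt_ringInverse ℝ (isUnit_one_sub_of_norm_lt hx).unit
  exact (h.comp x (contDiff_const.sub hT).contDiffAt).clm_apply hg.contDiffAt

end Resolvent

/-! ### The linear characteristic problem -/

namespace Characteristic

/-- Continuous functions on the unit square. -/
abbrev Sq : Type := C(Icc (0 : ℝ) 1 × Icc (0 : ℝ) 1, ℝ)

/-- The retraction of the line onto the unit interval. -/
noncomputable abbrev clamp (s : ℝ) : Icc (0 : ℝ) 1 := projIcc 0 1 zero_le_one s

theorem coe_clamp {s : ℝ} (hs : s ∈ Icc (0 : ℝ) 1) : (clamp s : ℝ) = s := by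
  rw [clamp, projIcc_of_mem zero_le_one hs]

theorem continuous_clamp : Continuous clamp := continuous_projIcc

theorem mem_Icc_of_mem_uIcc {a b : Icc (0 : ℝ) 1} {s : ℝ} (hs : s ∈ uIcc (a : ℝ) b) :
    s ∈ Icc (0 : ℝ) 1 :=
  uIcc_subset_Icc a.2 b.2 hs

/-- The Volterra operator `φ ↦ ∫_τ^σ φ(s, τ) ds` on the unit square. -/
noncomputable def volterra : Sq →L[ℝ] Sq :=
  LinearMap.mkContinuous
    { toFun := fun φ => ⟨fun p => ∫ s in (p.2 : ℝ)..p.1, φ (clamp s, p.2), by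
        have hc : Continuous (uncurry fun (p : Icc (0 : ℝ) 1 × Icc (0 : ℝ) 1) s =>
            φ (clamp s, p.2)) := by
          have := continuous_clamp
          fun_prop
        have hi (p : Icc (0 : ℝ) 1 × Icc (0 : ℝ) 1) (a b : ℝ) :
            IntervalIntegrable (fun s => φ (clamp s, p.2)) MeasureTheory.volume a b :=
          (hc.comp (Continuous.prodMk_right p)).intervalIntegrable a b
        have h := (intervalIntegral.continuous_parametric_intervalIntegral_of_continuous
            (a₀ := 0) (μ := MeasureTheory.volume) hc
            (continuous_subtype_val.comp continuous_fst)).sub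
          (intervalIntegral.continuous_parametric_intervalIntegral_of_continuous
            (a₀ := 0) (μ := MeasureTheory.volume) hc
            (continuous_subtype_val.comp continuous_snd))
        convert h using 2 with p
        exact (intervalIntegral.integral_interval_sub_left (hi p _ _) (hi p _ _)).symm⟩
      map_add' := fun φ ψ => by
        ext p
        have := continuous_clamp
        exact intervalIntegral.integral_add
          (Continuous.intervalIntegrable (by fun_prop) _ _)
          (Continuous.intervalIntegrable (by fun_prop) _ _)
      map_smul' := fun c φ => by
        ext p
        simp } 1 fun φ => by
    rw [ContinuousMap.norm_le _ (by positivity)]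
    intro p
    refine (intervalIntegral.norm_integral_le_of_norm_le_const
      (C := ‖φ‖) fun s _ => φ.norm_coe_le_norm _).trans ?_
    rw [mul_comm]
    gcongr
    rw [abs_le]
    constructor <;> linarith [p.1.2.1, p.1.2.2, p.2.2.1, p.2.2.2]

theorem volterra_apply (φ : Sq) (p : Icc (0 : ℝ) 1 × Icc (0 : ℝ) 1) :
    volterra φ p = ∫ s in (p.2 : ℝ)..p.1, φ (clamp s, p.2) := rfl

/-- Interchange of the two variables on the unit square. -/
def swapCLM : Sq →L[ℝ] Sq where
  toFun φ := φ.comp ⟨Prod.swap, continuous_swap⟩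
  map_add' _ _ := rfl
  map_smul' _ _ := rfl
  cont := ContinuousMap.continuous_precomp _

/-- The Volterra operator `φ ↦ ∫_σ^τ φ(σ, s) ds` on the unit square. -/
noncomputable def volterraSwap : Sq →L[ℝ] Sq := swapCLM.comp (volterra.comp swapCLM)

theorem volterraSwap_apply (φ : Sq) (p : Icc (0 : ℝ) 1 × Icc (0 : ℝ) 1) :
    volterraSwap φ p = ∫ s in (p.1 : ℝ)..p.2, φ (p.1, clamp s) := rfl

/-- The inclusion of the unit square into the plane. -/
def sqCoe : C(Icc (0 : ℝ) 1 × Icc (0 : ℝ) 1, ℝ × ℝ) :=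
  ⟨fun p => (p.1, p.2), by fun_prop⟩

/-- The pull-back of `k` to the unit square along the affine map which sends the corner `(0, 1)`
to `(α, β)` and the diagonal to the diagonal. -/
def pull {k : ℝ → ℝ → ℝ} (hk : SmoothTwo k) : C(ℝ × ℝ, Sq) :=
  sliceMap sqCoe ⟨fun z : (ℝ × ℝ) × (ℝ × ℝ) =>
    k (z.1.1 + (z.1.2 - z.1.1) * z.2.1) (z.1.1 + (z.1.2 - z.1.1) * z.2.2), by
    have := hk.continuous
    exact this.comp (by fun_prop : Continuous fun z : (ℝ × ℝ) × (ℝ × ℝ) =>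
      (z.1.1 + (z.1.2 - z.1.1) * z.2.1, z.1.1 + (z.1.2 - z.1.1) * z.2.2))⟩

section

variable {k k₁ k₂ g : ℝ → ℝ → ℝ} (hk : SmoothTwo k) (hk₁ : SmoothTwo k₁) (hk₂ : SmoothTwo k₂)
  (hg : SmoothTwo g)

theorem pull_apply (x : ℝ × ℝ) (p : Icc (0 : ℝ) 1 × Icc (0 : ℝ) 1) :
    pull hk x p = k (x.1 + (x.2 - x.1) * p.1) (x.1 + (x.2 - x.1) * p.2) := rfl

theorem contDiff_pull : ContDiff ℝ (⊤ : ℕ∞) (pull hk) :=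
  contDiff_sliceMap _ _ (hk.comp le_rfl (by fun_prop) (by fun_prop))

theorem pull_add {c : ℝ} (hper : ∀ α β, k (α + c) (β + c) = k α β) (x : ℝ × ℝ) :
    pull hk (x.1 + c, x.2 + c) = pull hk x := by
  ext p
  rw [pull_apply, pull_apply, ← hper (x.1 + (x.2 - x.1) * p.1)]
  congr 1 <;> ring

/-- Pointwise multiplication on the unit square. -/
noncomputable def mulCLM : Sq →L[ℝ] Sq →L[ℝ] Sq := ContinuousLinearMap.mul ℝ Sq

/-- The value at the corner `(0, 1)` of the unit square. -/
noncomputable def cornerCLM : Sq →L[ℝ] ℝ := ContinuousMap.evalCLM ℝ (0, 1)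

/-- The integral operator of the characteristic problem, transplanted to the unit square. -/
noncomputable def op (x : ℝ × ℝ) : Sq →L[ℝ] Sq :=
  (x.2 - x.1) • ((mulCLM (pull hk₁ x)).comp volterra +
    (mulCLM (pull hk₂ x)).comp volterraSwap)

theorem op_apply (x : ℝ × ℝ) (φ : Sq) (p : Icc (0 : ℝ) 1 × Icc (0 : ℝ) 1) :
    op hk₁ hk₂ x φ p = (x.2 - x.1) *
      (pull hk₁ x p * volterra φ p + pull hk₂ x p * volterraSwap φ p) := rfl

theorem contDiff_op : ContDiff ℝ (⊤ : ℕ∞) (op hk₁ hk₂) :=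
  contDiff_smul_comp_add mulCLM volterra volterraSwap (contDiff_snd.sub contDiff_fst)
    (contDiff_pull hk₁) (contDiff_pull hk₂)

/-- The solution of the transplanted characteristic problem. -/
noncomputable def sol (x : ℝ × ℝ) : Sq := Ring.inverse (1 - op hk₁ hk₂ x) (pull hg x)

theorem isUnit_one_sub_op {x : ℝ × ℝ} (hx : ‖op hk₁ hk₂ x‖ < 1) :
    IsUnit (1 - op hk₁ hk₂ x) := isUnit_one_sub_of_norm_lt hx

theorem contDiffAt_sol {x : ℝ × ℝ} (hx : ‖op hk₁ hk₂ x‖ < 1) :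
    ContDiffAt ℝ (⊤ : ℕ∞) (sol hk₁ hk₂ hg) x :=
  contDiffAt_inverse_one_sub_apply (contDiff_op hk₁ hk₂) (contDiff_pull hg) hx

theorem sol_eq {x : ℝ × ℝ} (hx : ‖op hk₁ hk₂ x‖ < 1) :
    sol hk₁ hk₂ hg x = op hk₁ hk₂ x (sol hk₁ hk₂ hg x) + pull hg x := by
  have h := congrArg (fun A : Sq →L[ℝ] Sq => A (pull hg x))
    (Ring.mul_inverse_cancel _ (isUnit_one_sub_op hk₁ hk₂ hx))
  have h' : sol hk₁ hk₂ hg x - op hk₁ hk₂ x (sol hk₁ hk₂ hg x) = pull hg x := h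
  rw [← h']
  abel

theorem eq_sol {x : ℝ × ℝ} (hx : ‖op hk₁ hk₂ x‖ < 1) {φ : Sq}
    (hφ : φ = op hk₁ hk₂ x φ + pull hg x) : φ = sol hk₁ hk₂ hg x := by
  have h := congrArg (fun A : Sq →L[ℝ] Sq => A φ)
    (Ring.inverse_mul_cancel _ (isUnit_one_sub_op hk₁ hk₂ hx))
  have h' : Ring.inverse (1 - op hk₁ hk₂ x) (φ - op hk₁ hk₂ x φ) = φ := h
  rw [← h', sol]
  congr 1
  exact sub_eq_iff_eq_add'.2 hφ

/-- The affine map of the unit interval which sends `0` to `σ` and `1` to `τ`. -/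
noncomputable def seg (σ τ : Icc (0 : ℝ) 1) : C(Icc (0 : ℝ) 1, Icc (0 : ℝ) 1) :=
  ⟨fun s => clamp (σ + (τ - σ) * s), continuous_clamp.comp (by fun_prop)⟩

theorem coe_seg (σ τ s : Icc (0 : ℝ) 1) : (seg σ τ s : ℝ) = σ + (τ - σ) * s := by
  refine coe_clamp ?_
  have := (convex_Icc (0 : ℝ) 1) σ.2 τ.2 (sub_nonneg.2 s.2.2) s.2.1 (by ring)
  convert this using 1
  simp only [smul_eq_mul]
  ring

theorem seg_clamp (σ τ : Icc (0 : ℝ) 1) {s : ℝ} (hs : s ∈ Icc (0 : ℝ) 1) :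
    seg σ τ (clamp s) = clamp (σ + (τ - σ) * s) := by
  simp [seg, coe_clamp hs]

/-- Solutions on nested squares agree. -/
theorem sol_comp_seg {x : ℝ × ℝ} (hx : ‖op hk₁ hk₂ x‖ < 1) (σ τ : Icc (0 : ℝ) 1)
    (hx' : ‖op hk₁ hk₂ (x.1 + (x.2 - x.1) * σ, x.1 + (x.2 - x.1) * τ)‖ < 1) :
    (sol hk₁ hk₂ hg x).comp ((seg σ τ).prodMap (seg σ τ)) =
      sol hk₁ hk₂ hg (x.1 + (x.2 - x.1) * σ, x.1 + (x.2 - x.1) * τ) := by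
  refine eq_sol hk₁ hk₂ hg hx' ?_
  set φ := sol hk₁ hk₂ hg x with hφ
  ext p
  have hpull {k : ℝ → ℝ → ℝ} (hk : SmoothTwo k) :
      pull hk (x.1 + (x.2 - x.1) * σ, x.1 + (x.2 - x.1) * τ) p =
        pull hk x (seg σ τ p.1, seg σ τ p.2) := by
    rw [pull_apply, pull_apply]
    simp only [coe_seg]
    congr 1 <;> ring
  have hv : ((τ : ℝ) - σ) * volterra (φ.comp ((seg σ τ).prodMap (seg σ τ))) p =
      volterra φ (seg σ τ p.1, seg σ τ p.2) := by
    rw [volterra_apply, volterra_apply]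
    have h := intervalIntegral.smul_integral_comp_add_mul (a := p.2) (b := p.1)
      (fun s => φ (clamp s, seg σ τ p.2)) ((τ : ℝ) - σ) σ
    simp only [coe_seg]
    rw [smul_eq_mul] at h
    rw [← h]
    congr 1
    refine intervalIntegral.integral_congr fun s hs => ?_
    simp only [ContinuousMap.comp_apply, ContinuousMap.prodMap_apply, Prod.map_apply]
    rw [seg_clamp σ τ (mem_Icc_of_mem_uIcc hs)]
  have hw : ((τ : ℝ) - σ) * volterraSwap (φ.comp ((seg σ τ).prodMap (seg σ τ))) p =
      volterraSwap φ (seg σ τ p.1, seg σ τ p.2) := by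
    rw [volterraSwap_apply, volterraSwap_apply]
    have h := intervalIntegral.smul_integral_comp_add_mul (a := p.1) (b := p.2)
      (fun s => φ (seg σ τ p.1, clamp s)) ((τ : ℝ) - σ) σ
    simp only [coe_seg]
    rw [smul_eq_mul] at h
    rw [← h]
    congr 1
    refine intervalIntegral.integral_congr fun s hs => ?_
    simp only [ContinuousMap.comp_apply, ContinuousMap.prodMap_apply, Prod.map_apply]
    rw [seg_clamp σ τ (mem_Icc_of_mem_uIcc hs)]
  have heq := congrArg (fun ψ : Sq => ψ (seg σ τ p.1, seg σ τ p.2)) (sol_eq hk₁ hk₂ hg hx)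
  simp only [ContinuousMap.add_apply, op_apply, ← hφ] at heq
  rw [ContinuousMap.comp_apply, ContinuousMap.add_apply, op_apply, hpull hk₁, hpull hk₂, hpull hg,
    ContinuousMap.prodMap_apply, Prod.map_apply, heq, ← hv, ← hw]
  ring

end

/-- Solvability of the linear characteristic problem near the diagonal. -/
theorem exists_solution {k₁ k₂ g : ℝ → ℝ → ℝ} (hk₁ : SmoothTwo k₁) (hk₂ : SmoothTwo k₂)
    (hg : SmoothTwo g) (hp₁ : ∀ α β, k₁ (α + 2 * π) (β + 2 * π) = k₁ α β)
    (hp₂ : ∀ α β, k₂ (α + 2 * π) (β + 2 * π) = k₂ α β)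
    (hpg : ∀ α β, g (α + 2 * π) (β + 2 * π) = g α β) :
    ∃ δ > (0 : ℝ), ∃ G : ℝ → ℝ → ℝ, SmoothTwo G ∧
      (∀ α β, G (α + 2 * π) (β + 2 * π) = G α β) ∧
      ∀ α β, |β - α| < δ → G α β =
        g α β + k₁ α β * (∫ x in β..α, G x β) + k₂ α β * ∫ y in α..β, G α y := by
  obtain ⟨δ, hδ, hop⟩ : ∃ δ > (0 : ℝ), ∀ α β, |β - α| < δ → ‖op hk₁ hk₂ (α, β)‖ < 1 := by
    obtain ⟨δ, hδ, h⟩ := exists_strip_pos (F := fun α d => 1 - ‖op hk₁ hk₂ (α, α + d)‖)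
      (by
        have h := (contDiff_op hk₁ hk₂).continuous
        have h' : Continuous fun p : ℝ × ℝ => op hk₁ hk₂ (p.1, p.1 + p.2) :=
          h.comp (by fun_prop)
        exact continuous_const.sub (continuous_norm_comp h'))
      (fun α d => by
        have e : op hk₁ hk₂ (α + 2 * π, α + 2 * π + d) = op hk₁ hk₂ (α, α + d) := by
          have e1 := pull_add hk₁ hp₁ (α, α + d)
          have e2 := pull_add hk₂ hp₂ (α, α + d)
          rw [show α + 2 * π + d = α + d + 2 * π by ring, op, op]
          simp only [] at e1 e2 ⊢
          rw [e1, e2]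
          congr 1
          ring
        simp only [e])
      (fun α => sub_pos.2 (norm_zero_smul_lt_one (by simp) _))
    refine ⟨δ, hδ, fun α β hd => ?_⟩
    have := h α (β - α) hd
    rw [add_sub_cancel] at this
    linarith
  let G₀ : ℝ → ℝ → ℝ := fun α β => sol hk₁ hk₂ hg (α, β) (0, 1)
  have hG₀per : ∀ α β, G₀ (α + 2 * π) (β + 2 * π) = G₀ α β := by
    intro α β
    have e1 := pull_add hk₁ hp₁ (α, β)
    have e2 := pull_add hk₂ hp₂ (α, β)
    have e3 := pull_add hg hpg (α, β)
    simp only [] at e1 e2 e3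
    simp only [G₀, sol, op, e1, e2, e3]
    congr 5
    ring
  have hsol : ∀ α β, |β - α| < δ → ∀ σ τ : Icc (0 : ℝ) 1,
      sol hk₁ hk₂ hg (α, β) (σ, τ) = G₀ (α + (β - α) * σ) (α + (β - α) * τ) := by
    intro α β hd σ τ
    have h := sol_comp_seg hk₁ hk₂ hg (hop α β hd) σ τ (hop _ _ ?_)
    · have h' := congrArg (fun ψ : Sq => ψ (0, 1)) h
      simp only [ContinuousMap.comp_apply, ContinuousMap.prodMap_apply, Prod.map_apply] at h'
      simp only [G₀, ← h']
      congr 2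
      · ext
        simp [coe_seg]
      · ext
        simp [coe_seg]
    · have e : α + (β - α) * τ - (α + (β - α) * σ) = (β - α) * (τ - σ) := by ring
      have h1 : |(τ : ℝ) - σ| ≤ 1 := by
        rw [abs_le]
        constructor <;> linarith [σ.2.1, σ.2.2, τ.2.1, τ.2.2]
      rw [e, abs_mul]
      exact (mul_le_of_le_one_right (abs_nonneg _) h1).trans_lt hd
  have heq : ∀ α β, |β - α| < δ → G₀ α β =
      g α β + k₁ α β * (∫ x in β..α, G₀ x β) + k₂ α β * ∫ y in α..β, G₀ α y := by
    intro α β hd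
    have h := congrArg (fun ψ : Sq => ψ (0, 1)) (sol_eq hk₁ hk₂ hg (hop α β hd))
    simp only [ContinuousMap.add_apply, op_apply, pull_apply, volterra_apply,
      volterraSwap_apply, hsol α β hd] at h
    have h1 := intervalIntegral.smul_integral_comp_add_mul (a := 1) (b := 0)
      (fun x => G₀ x β) (β - α) α
    have h2 := intervalIntegral.smul_integral_comp_add_mul (a := 0) (b := 1)
      (fun y => G₀ α y) (β - α) α
    have c1 : ∫ s in (1 : ℝ)..0, G₀ (α + (β - α) * (clamp s)) β =
        ∫ s in (1 : ℝ)..0, G₀ (α + (β - α) * s) β :=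
      intervalIntegral.integral_congr fun s hs => by
        rw [uIcc_comm, uIcc_of_le zero_le_one] at hs
        simp only [coe_clamp hs]
    have c2 : ∫ s in (0 : ℝ)..1, G₀ α (α + (β - α) * (clamp s)) =
        ∫ s in (0 : ℝ)..1, G₀ α (α + (β - α) * s) :=
      intervalIntegral.integral_congr fun s hs => by
        rw [uIcc_of_le zero_le_one] at hs
        simp only [coe_clamp hs]
    simp only [smul_eq_mul, mul_one, mul_zero, add_zero, add_sub_cancel] at h1 h2
    simp only [Icc.coe_zero, Icc.coe_one, mul_one, mul_zero, add_zero, add_sub_cancel, c1, c2] at h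
    rw [h, ← h1, ← h2]
    ring
  let χ : ContDiffBump (0 : ℝ) := ⟨δ / 2, 3 * δ / 4, by positivity, by linarith⟩
  have hχ : ∀ α β, |β - α| < δ / 2 → χ (β - α) * G₀ α β = G₀ α β := by
    intro α β hd
    rw [χ.one_of_mem_closedBall, one_mul]
    simpa using hd.le
  refine ⟨δ / 2, by positivity, fun α β => χ (β - α) * G₀ α β, ?_, ?_, ?_⟩
  · refine contDiff_iff_contDiffAt.2 fun p => ?_
    rcases lt_or_ge |p.2 - p.1| δ with hd | hd
    · have h1 : ContDiffAt ℝ (⊤ : ℕ∞) (uncurry G₀) p :=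
        contDiffAt_clm_comp cornerCLM (contDiffAt_sol hk₁ hk₂ hg (x := p) (hop p.1 p.2 hd))
      have h2 : ContDiffAt ℝ (⊤ : ℕ∞) (fun p : ℝ × ℝ => χ (p.2 - p.1)) p :=
        (χ.contDiff.comp (contDiff_snd.sub contDiff_fst)).contDiffAt
      exact h2.mul h1
    · refine (contDiffAt_const (c := (0 : ℝ))).congr_of_eventuallyEq ?_
      have hc : Continuous fun p : ℝ × ℝ => |p.2 - p.1| := by fun_prop
      filter_upwards [hc.continuousAt.eventually
        (lt_mem_nhds (show 3 * δ / 4 < |p.2 - p.1| by linarith))] with z hz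
      have : χ (z.2 - z.1) = 0 := χ.zero_of_le_dist (by simpa using hz.le)
      simp [uncurry, this]
  · intro α β
    simp only [hG₀per]
    congr 2
    ring
  · intro α β hd
    have c1 : ∫ x in β..α, χ (β - x) * G₀ x β = ∫ x in β..α, G₀ x β :=
      intervalIntegral.integral_congr fun x hx => by
        refine hχ x β ?_
        rw [abs_sub_comm]
        refine (abs_sub_left_of_mem_uIcc hx).trans_lt ?_
        rwa [abs_sub_comm]
    have c2 : ∫ y in α..β, χ (y - α) * G₀ α y = ∫ y in α..β, G₀ α y :=
      intervalIntegral.integral_congr fun y hy =>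
        hχ α y ((abs_sub_left_of_mem_uIcc hy).trans_lt hd)
    simp only [c1, c2, hχ α β hd]
    exact heq α β (by linarith)

end Characteristic

/-! ### A linear hyperbolic Cauchy problem in characteristic coordinates -/

theorem hasDerivAt_integral_right {g : ℝ → ℝ} (hg : Continuous g) (a b : ℝ) :
    HasDerivAt (fun x => ∫ s in a..x, g s) (g b) b :=
  intervalIntegral.integral_hasDerivAt_right (hg.intervalIntegrable _ _)
    (hg.stronglyMeasurableAtFilter _ _) hg.continuousAt

theorem integral_add_add_period {G : ℝ → ℝ} {c : ℝ} {H : ℝ → ℝ} (h : ∀ s, G (s + c) = H s)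
    (a b : ℝ) : ∫ s in (a + c)..(b + c), G s = ∫ s in a..b, H s := by
  rw [← intervalIntegral.integral_comp_add_right]
  simp only [h]

/-- The Cauchy problem `τ_αβ = q (P τ_β - R τ_α) / 2` with Cauchy data `τ = 0`,
`τ_α = u₀`, `τ_β = -u₀` on the diagonal is solvable near the diagonal. -/
theorem exists_cauchy_diagonal {u₀ P R : ℝ → ℝ} {q : ℝ → ℝ → ℝ} (hu : ContDiff ℝ (⊤ : ℕ∞) u₀)
    (hP : ContDiff ℝ (⊤ : ℕ∞) P) (hR : ContDiff ℝ (⊤ : ℕ∞) R) (hq : SmoothTwo q)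
    (hup : ∀ x, u₀ (x + 2 * π) = u₀ x) (hPp : ∀ x, P (x + 2 * π) = P x)
    (hRp : ∀ x, R (x + 2 * π) = R x) (hqp : ∀ α β, q (α + 2 * π) (β + 2 * π) = q α β) :
    ∃ δ > (0 : ℝ), ∃ τ : ℝ → ℝ → ℝ, SmoothTwo τ ∧
      (∀ α β, τ (α + 2 * π) (β + 2 * π) = τ α β) ∧ (∀ α, τ α α = 0) ∧
      (∀ α, pdθ τ α α = u₀ α) ∧ (∀ α, pdt τ α α = -u₀ α) ∧
      ∀ α β, |β - α| < δ → pdt (pdθ τ) α β =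
        q α β / 2 * (P α * pdt τ α β - R β * pdθ τ α β) := by
  have hfst {g : ℝ → ℝ} (hg : ContDiff ℝ (⊤ : ℕ∞) g) : SmoothTwo fun α _ => g α :=
    hg.comp contDiff_fst
  have hsnd {g : ℝ → ℝ} (hg : ContDiff ℝ (⊤ : ℕ∞) g) : SmoothTwo fun _ β => g β :=
    hg.comp contDiff_snd
  obtain ⟨δ, hδ, G, hG, hGp, hGeq⟩ := Characteristic.exists_solution
    (k₁ := fun α β => q α β * P α / 2) (k₂ := fun α β => -(q α β * R β) / 2)
    (g := fun α β => q α β / 2 * (-(P α * u₀ β) - R β * u₀ α))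
    ((ContDiff.mul hq (hfst hP)).div_const 2) ((ContDiff.mul hq (hsnd hR)).neg.div_const 2)
    ((ContDiff.div_const hq 2).mul
      (((hfst hP).mul (hsnd hu)).neg.sub ((hsnd hR).mul (hfst hu))))
    (fun α β => by simp only [hqp, hPp]) (fun α β => by simp only [hqp, hRp])
    (fun α β => by simp only [hqp, hRp, hPp, hup])
  let u : ℝ → ℝ → ℝ := fun α β => u₀ α + ∫ y in α..β, G α y
  let v : ℝ → ℝ → ℝ := fun α β => -u₀ β + ∫ x in β..α, G x β
  have hus : SmoothTwo u := (hfst hu).add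
    (SmoothTwo.contDiff_primitive (E := ℝ × ℝ) (G := fun p y => G p.1 y)
      (hG.comp le_rfl (by fun_prop) (by fun_prop)) contDiff_fst contDiff_snd)
  have hvs : SmoothTwo v := (hsnd hu).neg.add
    (SmoothTwo.contDiff_primitive (E := ℝ × ℝ) (G := fun p x => G x p.2)
      (hG.comp le_rfl (by fun_prop) (by fun_prop)) contDiff_snd contDiff_fst)
  let τ : ℝ → ℝ → ℝ := fun α β => ∫ x in β..α, u x β
  have hτ : SmoothTwo τ :=
    SmoothTwo.contDiff_primitive (E := ℝ × ℝ) (G := fun p x => u x p.2)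
      (hus.comp le_rfl (by fun_prop) (by fun_prop)) contDiff_snd contDiff_fst
  have hτα : pdθ τ = u := by
    funext α β
    exact (hasDerivAt_integral_right (hus.continuous.comp (Continuous.prodMk_left β)) β α).deriv
  have huβ (α β : ℝ) : pdt u α β = G α β :=
    ((hasDerivAt_integral_right (hG.continuous.comp (Continuous.prodMk_right α)) α β).const_add
      (u₀ α)).deriv
  have hvα (α β : ℝ) : HasDerivAt (fun x => v x β) (G α β) α :=
    (hasDerivAt_integral_right (hG.continuous.comp (Continuous.prodMk_left β)) β α).const_add _
  have hdiag (α : ℝ) : τ α α = 0 := intervalIntegral.integral_same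
  have hudiag (α : ℝ) : u α α = u₀ α := by simp [u]
  have hτβdiag (β : ℝ) : pdt τ β β = -u₀ β := by
    have h := hτ.hasDerivAt_comp (hasDerivAt_id β) (hasDerivAt_id β)
    simp only [id, hdiag, hτα, hudiag, mul_one] at h
    linarith [h.unique (hasDerivAt_const β (0 : ℝ))]
  have hτβ : pdt τ = v := by
    funext α β
    have hd (x : ℝ) : HasDerivAt (fun x => pdt τ x β - v x β) 0 x := by
      have h := (hτ.pdt.hasDerivAt_fst x β).sub (hvα x β)
      rwa [hτ.pd_comm, hτα, huβ, sub_self] at h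
    have h := is_const_of_deriv_eq_zero (fun x => (hd x).differentiableAt)
      (fun x => (hd x).deriv) α β
    simp only [hτβdiag] at h
    simp only [v, intervalIntegral.integral_same] at h ⊢
    linarith
  refine ⟨δ, hδ, τ, hτ, fun α β => ?_, hdiag, fun α => by rw [hτα, hudiag], hτβdiag,
    fun α β hd => ?_⟩
  · refine integral_add_add_period (fun x => ?_) β α
    simp only [u, hup]
    rw [integral_add_add_period fun y => hGp x y]
  · rw [hτα, hτβ, huβ, hGeq α β hd]
    simp only [u, v]
    ring

/-! ### Inversion of maps close to the identity -/

/-- A smooth contractive perturbation of the identity has a smooth inverse. -/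
theorem exists_contDiff_inverse_id_add {X : Type} [NormedAddCommGroup X] [NormedSpace ℝ X]
    [CompleteSpace X] [Nontrivial X] {W : X → X} {n : WithTop ℕ∞} (hn : n ≠ 0)
    (hW : ContDiff ℝ n W) {K : NNReal} (hK : K < 1) (hL : LipschitzWith K W) :
    ∃ g : X → X, ContDiff ℝ n g ∧ (∀ y, g y + W (g y) = y) ∧ ∀ x, g (x + W x) = x := by
  have happ : ApproximatesLinearOn (fun x => x + W x)
      (ContinuousLinearEquiv.refl ℝ X : X →L[ℝ] X) univ K := by
    rw [ApproximatesLinearOn.approximatesLinearOn_iff_lipschitzOnWith, lipschitzOnWith_univ]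
    convert hL using 1
    ext x
    simp
  have hc : K < ‖((ContinuousLinearEquiv.refl ℝ X).symm : X →L[ℝ] X)‖₊⁻¹ := by
    have : ‖((ContinuousLinearEquiv.refl ℝ X).symm : X →L[ℝ] X)‖₊ = 1 :=
      NNReal.eq ContinuousLinearMap.norm_id
    rwa [this, inv_one]
  let Φ : X ≃ₜ X := happ.toHomeomorph _ (Or.inr hc)
  have hΦ (x : X) : Φ x = x + W x := rfl
  have hder (x : X) : ∃ e : X ≃L[ℝ] X, HasFDerivAt Φ (e : X →L[ℝ] X) x := by
    have hn' : ‖-fderiv ℝ W x‖ < 1 := by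
      rw [norm_neg]
      exact (norm_fderiv_le_of_lipschitz ℝ hL).trans_lt hK
    refine ⟨ContinuousLinearEquiv.ofUnit (Units.oneSub _ hn'), ?_⟩
    have h := (hasFDerivAt_id x).add ((hW.differentiable hn) x).hasFDerivAt
    refine h.congr_fderiv ?_
    ext v
    change _ = ((1 : X →L[ℝ] X) - -fderiv ℝ W x) v
    simp
  choose e he using hder
  refine ⟨Φ.symm, Φ.contDiff_symm he (contDiff_id.add hW), fun y => ?_, fun x => ?_⟩
  · exact Φ.apply_symm_apply y
  · exact Φ.symm_apply_apply x

/-- Smooth truncations of the identity of the line with uniformly bounded slopes. -/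
theorem exists_truncation : ∃ C : NNReal, ∀ ε > (0 : ℝ), ∃ ρ : ℝ → ℝ, ContDiff ℝ (⊤ : ℕ∞) ρ ∧
    (∀ s, |s| ≤ ε → ρ s = s) ∧ (∀ s, |ρ s| ≤ 2 * ε) ∧ ∀ s s', |ρ s - ρ s'| ≤ C * |s - s'| := by
  let χ : ContDiffBump (0 : ℝ) := ⟨1, 2, one_pos, one_lt_two⟩
  let ρ₁ : ℝ → ℝ := fun s => s * χ s
  have h1 : ContDiff ℝ (⊤ : ℕ∞) ρ₁ := contDiff_id.mul χ.contDiff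
  obtain ⟨C, hC⟩ : ∃ C, LipschitzWith C ρ₁ := ContDiff.lipschitzWith_of_hasCompactSupport
    (HasCompactSupport.mul_left (f := fun s : ℝ => s) χ.hasCompactSupport) h1 (by simp)
  refine ⟨C, fun ε hε => ⟨fun s => ε * ρ₁ (s / ε), contDiff_const.mul
    (h1.comp (contDiff_id.div_const ε)), fun s hs => ?_, fun s => ?_, fun s s' => ?_⟩⟩
  · have : χ (s / ε) = 1 := χ.one_of_mem_closedBall (by
      rw [mem_closedBall_zero_iff, Real.norm_eq_abs, abs_div, abs_of_pos hε]
      exact (div_le_one hε).2 hs)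
    simp only [ρ₁, this]
    field_simp
  · have hb : |ρ₁ (s / ε)| ≤ 2 := by
      rcases le_or_gt 2 |s / ε| with h | h
      · have : χ (s / ε) = 0 := χ.zero_of_le_dist (by
          rwa [dist_zero_right, Real.norm_eq_abs])
        simp [ρ₁, this]
      · rw [abs_mul, abs_of_nonneg χ.nonneg]
        nlinarith [χ.nonneg (x := s / ε), χ.le_one (x := s / ε), abs_nonneg (s / ε)]
    rw [abs_mul, abs_of_pos hε]
    nlinarith
  · have h := hC.dist_le_mul (s / ε) (s' / ε)
    rw [Real.dist_eq, Real.dist_eq, ← sub_div, abs_div, abs_of_pos hε] at h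
    rw [← mul_sub, abs_mul, abs_of_pos hε]
    calc ε * |ρ₁ (s / ε) - ρ₁ (s' / ε)| ≤ ε * (C * (|s - s'| / ε)) := by gcongr
      _ = C * |s - s'| := by field_simp

theorem SmoothTwo.exists_strip_abs_lt {F : ℝ → ℝ → ℝ} (hF : Continuous (uncurry F))
    (hper : ∀ θ t, F (θ + 2 * π) t = F θ t) (h0 : ∀ θ, F θ 0 = 0) {η : ℝ} (hη : 0 < η) :
    ∃ T > (0 : ℝ), ∀ θ t, |t| < T → |F θ t| < η := by
  obtain ⟨T, hT, h⟩ := exists_strip_pos (F := fun θ t => η - |F θ t|)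
    (continuous_const.sub hF.abs) (fun θ t => by rw [hper]) (fun θ => by simpa [h0] using hη)
  exact ⟨T, hT, fun θ t ht => by linarith [h θ t ht]⟩

/-- A periodic function whose differential vanishes on the line `t = 0` is Lipschitz with a small
constant near this line. -/
theorem SmoothTwo.exists_strip_lipschitz {F : ℝ → ℝ → ℝ} (hF : SmoothTwo F)
    (hper : ∀ θ t, F (θ + 2 * π) t = F θ t) (h0 : ∀ θ, F θ 0 = 0) (h1 : ∀ θ, _root_.pdt F θ 0 = 0)
    {η : ℝ} (hη : 0 < η) :
    ∃ T > (0 : ℝ), ∀ θ t θ' t', |t| < T → |t'| < T →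
      |F θ t - F θ' t'| ≤ η * (|θ - θ'| + |t - t'|) := by
  have h0' (θ : ℝ) : _root_.pdθ F θ 0 = 0 := by simp [_root_.pdθ, h0]
  obtain ⟨T₁, hT₁, hb₁⟩ := exists_strip_abs_lt hF.pdθ.continuous (pdθ_periodic hper) h0' hη
  obtain ⟨T₂, hT₂, hb₂⟩ := exists_strip_abs_lt hF.pdt.continuous (pdt_periodic hper) h1 hη
  refine ⟨min T₁ T₂, lt_min hT₁ hT₂, fun θ t θ' t' ht ht' => ?_⟩
  have e₁ : |F θ t - F θ' t| ≤ η * |θ - θ'| :=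
    convex_univ.norm_image_sub_le_of_norm_hasDerivWithin_le (f := fun θ => F θ t)
      (fun θ _ => (hF.hasDerivAt_fst θ t).hasDerivWithinAt)
      (fun θ _ => (hb₁ θ t (ht.trans_le (min_le_left _ _))).le) (mem_univ _) (mem_univ _)
  have e₂ : |F θ' t - F θ' t'| ≤ η * |t - t'| :=
    (convex_ball (0 : ℝ) (min T₁ T₂)).norm_image_sub_le_of_norm_hasDerivWithin_le
      (f := fun t => F θ' t) (fun t _ => (hF.hasDerivAt_snd θ' t).hasDerivWithinAt)
      (fun t h => (hb₂ θ' t ((mem_ball_zero_iff.1 h).trans_le (min_le_right _ _))).le)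
      (mem_ball_zero_iff.2 ht') (mem_ball_zero_iff.2 ht)
  calc |F θ t - F θ' t'| ≤ |F θ t - F θ' t| + |F θ' t - F θ' t'| := abs_sub_le _ _ _
    _ ≤ η * (|θ - θ'| + |t - t'|) := by linarith

/-- Smooth local inversion of a map of the cylinder near the circle `t = 0`, on which the map and
its differential are the identity. -/
theorem exists_inverse_near_circle {F H : ℝ → ℝ → ℝ} (hF : SmoothTwo F) (hH : SmoothTwo H)
    (hFp : ∀ m s, F (m + 2 * π) s = F m s + 2 * π) (hHp : ∀ m s, H (m + 2 * π) s = H m s)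
    (hF0 : ∀ m, F m 0 = m) (hH0 : ∀ m, H m 0 = 0) (hF1 : ∀ m, pdt F m 0 = 0)
    (hH1 : ∀ m, pdt H m 0 = 1) :
    ∃ T > (0 : ℝ), ∃ M N : ℝ → ℝ → ℝ, SmoothTwo M ∧ SmoothTwo N ∧
      (∀ θ t, M (θ + 2 * π) t = M θ t + 2 * π) ∧ (∀ θ t, N (θ + 2 * π) t = N θ t) ∧
      (∀ θ, M θ 0 = θ) ∧ (∀ θ, N θ 0 = 0) ∧
      ∀ θ t, |t| < T → F (M θ t) (N θ t) = θ ∧ H (M θ t) (N θ t) = t := by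
  let F₁ : ℝ → ℝ → ℝ := fun m s => F m s - m
  let H₁ : ℝ → ℝ → ℝ := fun m s => H m s - s
  have hF₁ : SmoothTwo F₁ := ContDiff.sub hF contDiff_fst
  have hH₁ : SmoothTwo H₁ := ContDiff.sub hH contDiff_snd
  obtain ⟨C, hC⟩ := exists_truncation
  have hη : (0 : ℝ) < 1 / (2 * (1 + C)) := by positivity
  obtain ⟨T₁, hT₁, hl₁⟩ := hF₁.exists_strip_lipschitz
    (fun m s => by simp only [F₁, hFp]; ring) (fun m => by simp [F₁, hF0])
    (fun m => by
      have h := (hF.hasDerivAt_snd m 0).sub_const m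
      rw [hF1] at h
      exact h.deriv) hη
  obtain ⟨T₂, hT₂, hl₂⟩ := hH₁.exists_strip_lipschitz
    (fun m s => by simp only [H₁, hHp]) (fun m => by simp [H₁, hH0])
    (fun m => by
      have h := (hH.hasDerivAt_snd m 0).sub (hasDerivAt_id (0 : ℝ))
      rw [hH1, sub_self] at h
      exact h.deriv) hη
  have hε : 0 < min T₁ T₂ / 3 := by positivity
  obtain ⟨ρ, hρ, hρid, hρb, hρl⟩ := hC _ hε
  set ε := min T₁ T₂ / 3 with hεd
  have hρ₁ (s : ℝ) : |ρ s| < T₁ := (hρb s).trans_lt (by linarith [min_le_left T₁ T₂])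
  have hρ₂ (s : ℝ) : |ρ s| < T₂ := (hρb s).trans_lt (by linarith [min_le_right T₁ T₂])
  have hρ0 : ρ 0 = 0 := hρid 0 (by simpa using hε.le)
  let W : ℝ × ℝ → ℝ × ℝ := fun p => (F₁ p.1 (ρ p.2), H₁ p.1 (ρ p.2))
  have hW : ContDiff ℝ (⊤ : ℕ∞) W :=
    (hF₁.comp le_rfl contDiff_fst (hρ.comp contDiff_snd)).prodMk
      (hH₁.comp le_rfl contDiff_fst (hρ.comp contDiff_snd))
  have hWL : LipschitzWith (1 / 2) W := by
    refine LipschitzWith.of_dist_le_mul fun p p' => ?_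
    have h (p p' : ℝ × ℝ) : 1 / (2 * (1 + C)) * (|p.1 - p'.1| + |ρ p.2 - ρ p'.2|) ≤
        ((1 / 2 : NNReal) : ℝ) * dist p p' := by
      have d₁ : |p.1 - p'.1| ≤ dist p p' := le_max_left _ _
      have d₂ : |p.2 - p'.2| ≤ dist p p' := le_max_right _ _
      calc 1 / (2 * (1 + C)) * (|p.1 - p'.1| + |ρ p.2 - ρ p'.2|)
          ≤ 1 / (2 * (1 + C)) * (dist p p' + C * dist p p') := by
            gcongr
            exact (hρl _ _).trans (by gcongr)
        _ = ((1 / 2 : NNReal) : ℝ) * dist p p' := by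
            push_cast
            field_simp
    exact max_le ((hl₁ _ _ _ _ (hρ₁ _) (hρ₁ _)).trans (h p p'))
      ((hl₂ _ _ _ _ (hρ₂ _) (hρ₂ _)).trans (h p p'))
  obtain ⟨g, hg, hgr, hgl⟩ := exists_contDiff_inverse_id_add (by simp) hW
    (by rw [← NNReal.coe_lt_coe]; push_cast; norm_num) hWL
  have hg0 (θ : ℝ) : g (θ, 0) = (θ, 0) := by
    have h := hgl (θ, 0)
    simpa [W, F₁, H₁, hρ0, hF0, hH0] using h
  have hgp (θ t : ℝ) : g (θ + 2 * π, t) = g (θ, t) + (2 * π, 0) := by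
    have h := hgl (g (θ, t) + (2 * π, 0))
    have e : W (g (θ, t) + (2 * π, 0)) = W (g (θ, t)) := by
      simp only [W, F₁, H₁, Prod.fst_add, Prod.snd_add, hFp, hHp, add_zero,
        add_sub_add_right_eq_sub]
    rw [e, add_right_comm, hgr] at h
    simpa using h
  obtain ⟨T, hT, hN⟩ := SmoothTwo.exists_strip_abs_lt (F := fun θ t => (g (θ, t)).2)
    (contDiff_snd.comp hg).continuous (fun θ t => by simp [hgp]) (fun θ => by simp [hg0]) hε
  refine ⟨T, hT, fun θ t => (g (θ, t)).1, fun θ t => (g (θ, t)).2, contDiff_fst.comp hg,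
    contDiff_snd.comp hg, fun θ t => by simp [hgp], fun θ t => by simp [hgp],
    fun θ => by simp [hg0], fun θ => by simp [hg0], fun θ t ht => ?_⟩
  have h := hgr (θ, t)
  simp only [W, F₁, H₁, hρid _ (hN θ t ht).le] at h
  have h₁ := congrArg Prod.fst h
  have h₂ := congrArg Prod.snd h
  simp only [Prod.fst_add, Prod.snd_add, add_sub_cancel] at h₁ h₂
  exact ⟨h₁, h₂⟩

/-! ### Characteristic coordinates -/

/-- The normal angle as a function of the characteristic coordinates. -/
noncomputable def charAngle (f : ℝ → ℝ) (α β : ℝ) : ℝ := (α + β) / 2 + (f α - f β) / 2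

/-- The time derivative of the support function as a function of the characteristic
coordinates. -/
noncomputable def charSpeed (f : ℝ → ℝ) (α β : ℝ) : ℝ := (β - α) / 2 - (f α + f β) / 2

section CharacteristicCoordinates

variable {f : ℝ → ℝ} (hf : ContDiff ℝ (⊤ : ℕ∞) f)

include hf

theorem smoothTwo_charAngle : SmoothTwo (charAngle f) :=
  ((contDiff_fst.add contDiff_snd).div_const 2).add
    (((hf.comp contDiff_fst).sub (hf.comp contDiff_snd)).div_const 2)

theorem smoothTwo_charSpeed : SmoothTwo (charSpeed f) :=
  ((contDiff_snd.sub contDiff_fst).div_const 2).sub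
    (((hf.comp contDiff_fst).add (hf.comp contDiff_snd)).div_const 2)

theorem hasDerivAt_of_contDiff (x : ℝ) : HasDerivAt f (deriv f x) x :=
  (hf.differentiable (by simp) x).hasDerivAt

theorem pdθ_charAngle (α β : ℝ) : pdθ (charAngle f) α β = (1 + deriv f α) / 2 := by
  have h := (((hasDerivAt_id α).add_const β).div_const 2).add
    (((hasDerivAt_of_contDiff hf α).sub_const (f β)).div_const 2)
  exact h.deriv.trans (by ring)

theorem pdt_charAngle (α β : ℝ) : pdt (charAngle f) α β = (1 - deriv f β) / 2 := by
  have h := (((hasDerivAt_id β).const_add α).div_const 2).add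
    (((hasDerivAt_of_contDiff hf β).const_sub (f α)).div_const 2)
  exact h.deriv.trans (by ring)

theorem pdθ_charSpeed (α β : ℝ) : pdθ (charSpeed f) α β = -((1 + deriv f α) / 2) := by
  have h := (((hasDerivAt_id α).const_sub β).div_const 2).sub
    (((hasDerivAt_of_contDiff hf α).add_const (f β)).div_const 2)
  exact h.deriv.trans (by ring)

theorem pdt_charSpeed (α β : ℝ) : pdt (charSpeed f) α β = (1 - deriv f β) / 2 := by
  have h := (((hasDerivAt_id β).sub_const α).div_const 2).sub
    (((hasDerivAt_of_contDiff hf β).const_add (f α)).div_const 2)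
  exact h.deriv.trans (by ring)

/-- Existence of characteristic coordinates `α = A(θ, t)`, `β = B(θ, t)` for small `t`. The
function `τ` expresses the time in terms of these coordinates. -/
theorem exists_characteristic_coordinates (hfper : ∀ θ, f (θ + 2 * π) = f θ) {a₀ : ℝ → ℝ}
    (ha : ContDiff ℝ (⊤ : ℕ∞) a₀) (haper : ∀ θ, a₀ (θ + 2 * π) = a₀ θ) (ha0 : ∀ θ, 0 < a₀ θ) :
    ∃ T > (0 : ℝ), ∃ τ A B : ℝ → ℝ → ℝ, SmoothTwo τ ∧ SmoothTwo A ∧ SmoothTwo B ∧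
      (∀ α, pdθ τ α α = a₀ α / 2) ∧ (∀ α, pdt τ α α = -(a₀ α / 2)) ∧
      (∀ θ t, A (θ + 2 * π) t = A θ t + 2 * π) ∧ (∀ θ t, B (θ + 2 * π) t = B θ t + 2 * π) ∧
      (∀ θ, A θ 0 = θ) ∧ (∀ θ, B θ 0 = θ) ∧
      ∀ θ t, |t| < T → charAngle f (A θ t) (B θ t) = θ ∧ τ (A θ t) (B θ t) = t ∧
        pdt (pdθ τ) (A θ t) (B θ t) = charSpeed f (A θ t) (B θ t) / 2 *
          ((1 + deriv f (A θ t)) / 2 * pdt τ (A θ t) (B θ t) -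
            (1 - deriv f (B θ t)) / 2 * pdθ τ (A θ t) (B θ t)) := by
  have hf' : ContDiff ℝ (⊤ : ℕ∞) (deriv f) := (contDiff_infty_iff_deriv.1 hf).2
  have hf'per (θ : ℝ) : deriv f (θ + 2 * π) = deriv f θ := by
    rw [← deriv_comp_add_const]
    simp only [hfper]
  have hϑper (α β : ℝ) : charAngle f (α + 2 * π) (β + 2 * π) = charAngle f α β + 2 * π := by
    simp only [charAngle, hfper]
    ring
  obtain ⟨δ, hδ, τ, hτ, hτper, hτ0, hτα, hτβ, hτeq⟩ := exists_cauchy_diagonal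
    (ha.div_const 2) ((contDiff_const.add hf').div_const 2) ((contDiff_const.sub hf').div_const 2)
    (smoothTwo_charSpeed hf) (fun x => by simp only [haper])
    (P := fun x => (1 + deriv f x) / 2) (R := fun x => (1 - deriv f x) / 2)
    (fun x => by simp only [hf'per]) (fun x => by simp only [hf'per])
    (fun α β => by simp only [charSpeed, hfper]; ring)
  let c : ℝ → ℝ := fun m => (1 - deriv f m) / a₀ m
  let d : ℝ → ℝ := fun m => -(1 + deriv f m) / a₀ m
  have hc : ContDiff ℝ (⊤ : ℕ∞) c := (contDiff_const.sub hf').div ha fun x => (ha0 x).ne'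
  have hd : ContDiff ℝ (⊤ : ℕ∞) d := (contDiff_const.add hf').neg.div ha fun x => (ha0 x).ne'
  have hcper (x : ℝ) : c (x + 2 * π) = c x := by simp only [c, hf'per, haper]
  have hdper (x : ℝ) : d (x + 2 * π) = d x := by simp only [d, hf'per, haper]
  have hX {k : ℝ → ℝ} (hk : ContDiff ℝ (⊤ : ℕ∞) k) : SmoothTwo fun m s => m + s * k m :=
    contDiff_fst.add (contDiff_snd.mul (hk.comp contDiff_fst))
  have hX' (k : ℝ → ℝ) (m : ℝ) : HasDerivAt (fun s => m + s * k m) (k m) 0 := by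
    simpa using ((hasDerivAt_id (0 : ℝ)).mul_const (k m)).const_add m
  obtain ⟨T₁, hT₁, M, N, hM, hN, hMper, hNper, hM0, hN0, hinv⟩ := exists_inverse_near_circle
    (F := fun m s => charAngle f (m + s * c m) (m + s * d m))
    (H := fun m s => τ (m + s * c m) (m + s * d m))
    ((smoothTwo_charAngle hf).comp le_rfl (hX hc) (hX hd)) (hτ.comp le_rfl (hX hc) (hX hd))
    (fun m s => by
      rw [← hϑper]
      simp only [hcper, hdper]
      congr 1 <;> ring)
    (fun m s => by
      rw [← hτper (m + s * c m)]
      simp only [hcper, hdper]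
      congr 1 <;> ring)
    (fun m => by simp [charAngle]) (fun m => by simp [hτ0])
    (fun m => by
      have h := (smoothTwo_charAngle hf).hasDerivAt_comp (hX' c m) (hX' d m)
      refine h.deriv.trans ?_
      simp only [pdθ_charAngle hf, pdt_charAngle hf, zero_mul, add_zero, c, d]
      ring)
    (fun m => by
      have h := hτ.hasDerivAt_comp (hX' c m) (hX' d m)
      refine h.deriv.trans ?_
      have := (ha0 m).ne'
      simp only [zero_mul, add_zero, hτα, hτβ, c, d]
      field_simp
      ring)
  have hA {k : ℝ → ℝ} (hk : ContDiff ℝ (⊤ : ℕ∞) k) :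
      SmoothTwo fun θ t => M θ t + N θ t * k (M θ t) := ContDiff.add hM (ContDiff.mul hN (hk.comp hM))
  obtain ⟨T₂, hT₂, hsmall⟩ := SmoothTwo.exists_strip_abs_lt
    (F := fun θ t => M θ t + N θ t * d (M θ t) - (M θ t + N θ t * c (M θ t)))
    (ContDiff.sub (hA hd) (hA hc)).continuous
    (fun θ t => by simp only [hMper, hNper, hcper, hdper]; ring)
    (fun θ => by simp [hN0]) hδ
  refine ⟨min T₁ T₂, lt_min hT₁ hT₂, τ, fun θ t => M θ t + N θ t * c (M θ t),
    fun θ t => M θ t + N θ t * d (M θ t), hτ, hA hc, hA hd, hτα, hτβ,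
    fun θ t => by simp only [hMper, hNper, hcper]; ring,
    fun θ t => by simp only [hMper, hNper, hdper]; ring,
    fun θ => by simp [hM0, hN0], fun θ => by simp [hM0, hN0], fun θ t ht => ?_⟩
  obtain ⟨h₁, h₂⟩ := hinv θ t (ht.trans_le (min_le_left _ _))
  exact ⟨h₁, h₂, hτeq _ _ (hsmall θ t (ht.trans_le (min_le_right _ _)))⟩

end CharacteristicCoordinates

/-- The mixed second derivative of `τ`, read off in new coordinates. -/
theorem pdt_sub_pdθ_of_coordinates {τ A B : ℝ → ℝ → ℝ} (hτ : SmoothTwo τ) (hA : SmoothTwo A)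
    (hB : SmoothTwo B) (θ t : ℝ) :
    pdt (fun θ t => pdθ τ (A θ t) (B θ t) * pdθ A θ t - pdt τ (A θ t) (B θ t) * pdθ B θ t) θ t -
      pdθ (fun θ t => pdθ τ (A θ t) (B θ t) * pdt A θ t - pdt τ (A θ t) (B θ t) * pdt B θ t) θ t =
    2 * pdt (pdθ τ) (A θ t) (B θ t) * (pdθ A θ t * pdt B θ t - pdt A θ t * pdθ B θ t) := by
  have h₁ := ((hτ.pdθ.hasDerivAt_comp (hA.hasDerivAt_snd θ t) (hB.hasDerivAt_snd θ t)).mul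
    (hA.pdθ.hasDerivAt_snd θ t)).sub
    ((hτ.pdt.hasDerivAt_comp (hA.hasDerivAt_snd θ t) (hB.hasDerivAt_snd θ t)).mul
      (hB.pdθ.hasDerivAt_snd θ t))
  have h₂ := ((hτ.pdθ.hasDerivAt_comp (hA.hasDerivAt_fst θ t) (hB.hasDerivAt_fst θ t)).mul
    (hA.pdt.hasDerivAt_fst θ t)).sub
    ((hτ.pdt.hasDerivAt_comp (hA.hasDerivAt_fst θ t) (hB.hasDerivAt_fst θ t)).mul
      (hB.pdt.hasDerivAt_fst θ t))
  rw [hA.pd_comm, hB.pd_comm] at h₂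
  rw [hτ.pd_comm] at h₁ h₂
  refine (congrArg₂ (· - ·) h₁.deriv h₂.deriv).trans ?_
  ring

/-! ### Existence -/

/-- Two functions of two variables which agree for `t = 0` and have the same derivative in `t` for
`|t| < T` agree for `|t| < T`. -/
theorem SmoothTwo.eq_of_pdt_eq {F H : ℝ → ℝ → ℝ} (hF : SmoothTwo F) (hH : SmoothTwo H) {T θ t : ℝ}
    (h0 : F θ 0 = H θ 0) (h1 : ∀ s, |s| < T → _root_.pdt F θ s = _root_.pdt H θ s)
    (ht : |t| < T) : F θ t = H θ t := by
  have h := (convex_ball (0 : ℝ) T).norm_image_sub_le_of_norm_hasDerivWithin_le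
    (f := fun s => F θ s - H θ s) (C := 0)
    (fun s _ => ((hF.hasDerivAt_snd θ s).sub (hH.hasDerivAt_snd θ s)).hasDerivWithinAt)
    (fun s hs => by
      rw [h1 s (by simpa using hs), sub_self, norm_zero])
    (Metric.mem_ball_self ((abs_nonneg t).trans_lt ht)) (mem_ball_zero_iff.2 ht)
  rw [zero_mul, norm_le_zero_iff, h0, sub_self, sub_zero] at h
  exact sub_eq_zero.1 h

theorem exists_isMASol {h f : ℝ → ℝ} (hh : ContDiff ℝ (⊤ : ℕ∞) h)
    (hhper : ∀ θ, h (θ + 2 * π) = h θ) (hconv : ∀ θ, 0 < deriv (deriv h) θ + h θ)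
    (hf : ContDiff ℝ (⊤ : ℕ∞) f) (hfper : ∀ θ, f (θ + 2 * π) = f θ) :
    ∃ T > (0 : ℝ), ∃ S : ℝ → ℝ → ℝ, IsMASol h f T S := by
  have hh'' : ContDiff ℝ (⊤ : ℕ∞) (deriv (deriv h)) :=
    (contDiff_infty_iff_deriv.1 (contDiff_infty_iff_deriv.1 hh).2).2
  have hh''per (θ : ℝ) : deriv (deriv h) (θ + 2 * π) = deriv (deriv h) θ := by
    simp only [← deriv_comp_add_const, hhper]
  obtain ⟨T₁, hT₁, τ, A, B, hτ, hA, hB, hτα, hτβ, hAper, hBper, hA0, hB0, hAB⟩ :=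
    exists_characteristic_coordinates hf hfper (hh''.add hh)
      (fun θ => by simp only [hh''per, hhper]) hconv
  let Q : ℝ → ℝ → ℝ := fun θ t => charSpeed f (A θ t) (B θ t)
  have hQ : SmoothTwo Q := (smoothTwo_charSpeed hf).comp le_rfl hA hB
  have hQper (θ t : ℝ) : Q (θ + 2 * π) t = Q θ t := by
    simp only [Q, hAper, hBper, charSpeed, hfper]
    ring
  have hQ0 (θ : ℝ) : Q θ 0 = -f θ := by
    simp only [Q, hA0, hB0, charSpeed]
    ring
  let S : ℝ → ℝ → ℝ := fun θ t => h θ + ∫ s in (0 : ℝ)..t, Q θ s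
  have hS : SmoothTwo S := (hh.comp contDiff_fst).add
    (SmoothTwo.contDiff_primitive (E := ℝ × ℝ) (G := fun p s => Q p.1 s)
      (hQ.comp le_rfl (by fun_prop) (by fun_prop)) contDiff_const contDiff_snd)
  have hSper (θ t : ℝ) : S (θ + 2 * π) t = S θ t := by simp only [S, hhper, hQper]
  have hS0 (θ : ℝ) : S θ 0 = h θ := by simp [S]
  have hSt : pdt S = Q := by
    funext θ t
    exact ((hasDerivAt_integral_right (hQ.continuous.comp (Continuous.prodMk_right θ)) 0
      t).const_add (h θ)).deriv
  have hcurv0 (θ : ℝ) : curvRadius S θ 0 = deriv (deriv h) θ + h θ := by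
    simp only [curvRadius, pdθ, hS0]
  let U : ℝ → ℝ → ℝ := fun θ t => pdθ τ (A θ t) (B θ t)
  let V : ℝ → ℝ → ℝ := fun θ t => pdt τ (A θ t) (B θ t)
  have hU : SmoothTwo U := hτ.pdθ.comp le_rfl hA hB
  have hV : SmoothTwo V := hτ.pdt.comp le_rfl hA hB
  let a : ℝ → ℝ → ℝ := fun θ t => U θ t * pdθ A θ t - V θ t * pdθ B θ t
  have ha : SmoothTwo a := (ContDiff.mul hU hA.pdθ).sub (ContDiff.mul hV hB.pdθ)
  have ha0 (θ : ℝ) : a θ 0 = deriv (deriv h) θ + h θ := by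
    have e₁ : pdθ A θ 0 = 1 := by simp [pdθ, hA0]
    have e₂ : pdθ B θ 0 = 1 := by simp [pdθ, hB0]
    simp only [a, U, V, e₁, e₂, hA0, hB0, hτα, hτβ]
    ring
  have hsys (θ t : ℝ) (ht : |t| < T₁) :
      (1 + deriv f (A θ t)) / 2 * pdθ A θ t + (1 - deriv f (B θ t)) / 2 * pdθ B θ t = 1 ∧
      (1 + deriv f (A θ t)) / 2 * pdt A θ t + (1 - deriv f (B θ t)) / 2 * pdt B θ t = 0 ∧
      U θ t * pdθ A θ t + V θ t * pdθ B θ t = 0 ∧ U θ t * pdt A θ t + V θ t * pdt B θ t = 1 := by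
    have hev : ∀ᶠ s in nhds t, |s| < T₁ := continuous_abs.continuousAt.eventually (gt_mem_nhds ht)
    have hϑ := smoothTwo_charAngle hf
    refine ⟨?_, ?_, ?_, ?_⟩
    · have d := hϑ.hasDerivAt_comp (hA.hasDerivAt_fst θ t) (hB.hasDerivAt_fst θ t)
      rw [← pdθ_charAngle hf _ (B θ t), ← pdt_charAngle hf (A θ t)]
      exact d.unique ((hasDerivAt_id θ).congr_of_eventuallyEq
        (Filter.Eventually.of_forall fun y => (hAB y t ht).1))
    · have d := hϑ.hasDerivAt_comp (hA.hasDerivAt_snd θ t) (hB.hasDerivAt_snd θ t)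
      rw [← pdθ_charAngle hf _ (B θ t), ← pdt_charAngle hf (A θ t)]
      exact d.unique ((hasDerivAt_const t θ).congr_of_eventuallyEq
        (hev.mono fun s hs => (hAB θ s hs).1))
    · have d := hτ.hasDerivAt_comp (hA.hasDerivAt_fst θ t) (hB.hasDerivAt_fst θ t)
      exact d.unique ((hasDerivAt_const θ t).congr_of_eventuallyEq
        (Filter.Eventually.of_forall fun y => (hAB y t ht).2.1))
    · have d := hτ.hasDerivAt_comp (hA.hasDerivAt_snd θ t) (hB.hasDerivAt_snd θ t)
      exact d.unique ((hasDerivAt_id t).congr_of_eventuallyEq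
        (hev.mono fun s hs => (hAB θ s hs).2.1))
  have hQθ (θ t : ℝ) : pdθ Q θ t = -((1 + deriv f (A θ t)) / 2) * pdθ A θ t +
      (1 - deriv f (B θ t)) / 2 * pdθ B θ t := by
    rw [← pdθ_charSpeed hf _ (B θ t), ← pdt_charSpeed hf (A θ t)]
    exact ((smoothTwo_charSpeed hf).hasDerivAt_comp (hA.hasDerivAt_fst θ t)
      (hB.hasDerivAt_fst θ t)).deriv
  have hQt (θ t : ℝ) : pdt Q θ t = -((1 + deriv f (A θ t)) / 2) * pdt A θ t +
      (1 - deriv f (B θ t)) / 2 * pdt B θ t := by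
    rw [← pdθ_charSpeed hf _ (B θ t), ← pdt_charSpeed hf (A θ t)]
    exact ((smoothTwo_charSpeed hf).hasDerivAt_comp (hA.hasDerivAt_snd θ t)
      (hB.hasDerivAt_snd θ t)).deriv
  have hcramer {P R u v x y z w : ℝ} (e₁ : P * x + R * y = 1) (e₂ : P * z + R * w = 0)
      (e₃ : u * x + v * y = 0) (e₄ : u * z + v * w = 1) :
      (P * v - R * u) * (x * w - z * y) = 1 ∧ x = v * (x * w - z * y) ∧
        y = -u * (x * w - z * y) ∧ z = -R * (x * w - z * y) ∧ w = P * (x * w - z * y) := by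
    refine ⟨?_, ?_, ?_, ?_, ?_⟩
    · linear_combination (u * z + v * w) * e₁ - (u * x + v * y) * e₂ + e₄
    · linear_combination -x * e₄ + z * e₃
    · linear_combination -y * e₄ + w * e₃
    · linear_combination -z * e₁ + x * e₂
    · linear_combination -w * e₁ + y * e₂
  have hspin (θ t : ℝ) (ht : |t| < T₁) :
      U θ t * pdt A θ t - V θ t * pdt B θ t = pdθ Q θ t := by
    obtain ⟨e₁, e₂, e₃, e₄⟩ := hsys θ t ht
    obtain ⟨-, hx, hy, hz, hw⟩ := hcramer e₁ e₂ e₃ e₄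
    rw [hQθ]
    linear_combination U θ t * hz - V θ t * hw + (1 + deriv f (A θ t)) / 2 * hx -
      (1 - deriv f (B θ t)) / 2 * hy
  have hat (θ t : ℝ) (ht : |t| < T₁) : pdt a θ t = pdθ (pdθ Q) θ t + Q θ t := by
    have e := pdt_sub_pdθ_of_coordinates hτ hA hB θ t
    have e' : pdθ (fun θ t => pdθ τ (A θ t) (B θ t) * pdt A θ t -
        pdt τ (A θ t) (B θ t) * pdt B θ t) θ t = pdθ (pdθ Q) θ t := by
      unfold pdθ
      congr 1
      funext y
      exact hspin y t ht
    obtain ⟨e₁, e₂, e₃, e₄⟩ := hsys θ t ht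
    obtain ⟨hD, -⟩ := hcramer e₁ e₂ e₃ e₄
    rw [e', (hAB θ t ht).2.2] at e
    linear_combination e + Q θ t * hD
  have hcurv (θ t : ℝ) (ht : |t| < T₁) : curvRadius S θ t = a θ t :=
    hS.curvRadius.eq_of_pdt_eq ha (by rw [hcurv0, ha0])
      (fun s hs => by rw [pdt_curvRadius hS, hSt, hat θ s hs]) ht
  obtain ⟨T₂, hT₂, hpos⟩ := exists_strip_pos hS.curvRadius.continuous (curvRadius_periodic hSper)
    (fun θ => by rw [hcurv0]; exact hconv θ)
  refine ⟨min T₁ T₂, lt_min hT₁ hT₂, S, hS, hSper, hS0, fun θ => by rw [hSt, hQ0],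
    fun θ t ht => ?_⟩
  have habs : |t| < min T₁ T₂ := by rw [abs_of_nonneg ht.1]; exact ht.2
  refine ⟨hpos θ t (habs.trans_le (min_le_right _ _)), ?_⟩
  have ht₁ := habs.trans_le (min_le_left _ _)
  obtain ⟨e₁, e₂, e₃, e₄⟩ := hsys θ t ht₁
  obtain ⟨hD, hx, hy, hz, hw⟩ := hcramer e₁ e₂ e₃ e₄
  have hc := hcurv θ t ht₁
  simp only [curvRadius] at hc
  have hpde : a θ t * pdt Q θ t - pdθ Q θ t ^ 2 + 1 = 0 := by
    have ea : a θ t = 2 * U θ t * V θ t *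
        (pdθ A θ t * pdt B θ t - pdt A θ t * pdθ B θ t) := by
      linear_combination U θ t * hx - V θ t * hy
    rw [ea, hQt, ← hspin θ t ht₁]
    generalize pdθ A θ t * pdt B θ t - pdt A θ t * pdθ B θ t = D at *
    generalize (1 + deriv f (A θ t)) / 2 = P at *
    generalize (1 - deriv f (B θ t)) / 2 = R at *
    rw [hz, hw]
    linear_combination -((P * V θ t - R * U θ t) * D + 1) * hD
  rw [hSt]
  linear_combination hpde + pdt Q θ t * hc

/-- Local existence and uniqueness for the hyperbolic Monge–Ampère initial value problem
arising from the one-dimensional hyperbolic mean curvature flow: given the support function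
`h` of a smooth strictly convex closed curve (`h'' + h > 0`) and a smooth `2π`-periodic
initial velocity `f̃`, there are `T > 0` and a solution `S` on `ℝ × [0,T)`, and any two
solutions agree on the intersection of their time intervals. -/
theorem local_existence_and_uniqueness
    (h f : ℝ → ℝ)
    (hh : ContDiff ℝ (⊤ : ℕ∞) h) (hhper : ∀ θ, h (θ + 2 * π) = h θ)
    (hconv : ∀ θ, 0 < deriv (deriv h) θ + h θ)
    (hf : ContDiff ℝ (⊤ : ℕ∞) f) (hfper : ∀ θ, f (θ + 2 * π) = f θ) :
    (∃ T > (0:ℝ), ∃ S : ℝ → ℝ → ℝ, IsMASol h f T S) ∧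
    (∀ T₁ T₂ : ℝ, ∀ S₁ S₂ : ℝ → ℝ → ℝ, IsMASol h f T₁ S₁ → IsMASol h f T₂ S₂ →
      ∀ θ t, t ∈ Ico (0:ℝ) (min T₁ T₂) → S₁ θ t = S₂ θ t) := by
  exact ⟨exists_isMASol hh hhper hconv hf hfper,
    fun _ _ _ _ H₁ H₂ _ _ ht => H₁.unique H₂ ht⟩
end

section
/- Let r₀ > 0 and r₁ ≤ 0, and let R : [0,T*) → ℝ be the maximal positive solution of the ordinary differential equation R''(t) = −1/R(t) with R(0) = r₀ and R'(0) = r₁. Then T* is finite, R is nonincreasing on [0,T*) (strictly decreasing on (0,T*)), R(t) → 0 as t → T*, and T* ≤ √(π/2)·r₀, with equality T* = √(π/2)·r₀ holding if and only if r₁ = 0. -/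
open Real Set Filter Topology

/-- `R` is a positive solution of `R'' = −1/R`, `R(0) = r₀`, `R'(0) = r₁` on `[0, T)`
(where the endpoint `T` is an extended real, so `T = ⊤` means a global solution). -/
def IsCircleSol (r₀ r₁ : ℝ) (T : EReal) (R : ℝ → ℝ) : Prop :=
  R 0 = r₀ ∧ deriv R 0 = r₁ ∧
  ∀ t : ℝ, 0 ≤ t → (t : EReal) < T →
    0 < R t ∧ DifferentiableAt ℝ R t ∧ DifferentiableAt ℝ (deriv R) t ∧
    deriv (deriv R) t = -(1 / R t)

/-- The lower tail `∫_{-∞}^x e^{-s²/2} ds` of the unnormalised Gaussian. -/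
noncomputable def gaussianTail (x : ℝ) : ℝ := ∫ s in Iic x, exp (-(s ^ 2 / 2))

lemma continuous_exp_neg_half_sq : Continuous fun s : ℝ ↦ exp (-(s ^ 2 / 2)) := by
  fun_prop

lemma integrable_exp_neg_half_sq :
    MeasureTheory.Integrable fun s : ℝ ↦ exp (-(s ^ 2 / 2)) := by
  convert integrable_exp_neg_mul_sq (b := 1 / 2) (by norm_num) using 3
  ring

lemma hasStrictDerivAt_gaussianTail (x : ℝ) :
    HasStrictDerivAt gaussianTail (exp (-(x ^ 2 / 2))) x := by
  have h : gaussianTail = fun x ↦ gaussianTail 0 + ∫ s in (0 : ℝ)..x, exp (-(s ^ 2 / 2)) := by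
    ext y
    rw [← intervalIntegral.integral_Iic_sub_Iic integrable_exp_neg_half_sq.integrableOn
      integrable_exp_neg_half_sq.integrableOn]
    simp [gaussianTail]
  rw [h]
  exact (continuous_exp_neg_half_sq.integral_hasStrictDerivAt 0 x).const_add _

lemma strictMono_gaussianTail : StrictMono gaussianTail :=
  strictMono_of_deriv_pos fun x ↦ by
    rw [(hasStrictDerivAt_gaussianTail x).hasDerivAt.deriv]
    positivity

lemma gaussianTail_pos (x : ℝ) : 0 < gaussianTail x :=
  (MeasureTheory.setIntegral_nonneg measurableSet_Iic fun _ _ ↦ (exp_pos _).le).trans_lt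
    (strictMono_gaussianTail (sub_one_lt x))

lemma tendsto_gaussianTail_atBot : Tendsto gaussianTail atBot (𝓝 0) := by
  have h := MeasureTheory.intervalIntegral_tendsto_integral_Iic 0
    integrable_exp_neg_half_sq.integrableOn tendsto_id
  have h' := h.const_sub (gaussianTail 0)
  rw [← gaussianTail, sub_self] at h'
  refine h'.congr fun x ↦ ?_
  rw [← intervalIntegral.integral_Iic_sub_Iic integrable_exp_neg_half_sq.integrableOn
    integrable_exp_neg_half_sq.integrableOn]
  simp [gaussianTail]

lemma gaussianTail_zero : gaussianTail 0 = √(π / 2) := by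
  have h := integral_comp_neg_Iic 0 fun s : ℝ ↦ exp (-(s ^ 2 / 2))
  have h' := integral_gaussian_Ioi (1 / 2)
  simp only [neg_sq, neg_zero] at h
  rw [gaussianTail, h]
  calc _ = ∫ x in Ioi (0 : ℝ), exp (-(1 / 2) * x ^ 2) := by congr 1; ext x; congr 1; ring
    _ = √(π / (1 / 2)) / 2 := h'
    _ = _ := by
      rw [show π / (1 / 2) = π / 2 * 2 ^ 2 by ring, sqrt_mul (by positivity), sqrt_sq (by norm_num)]
      ring

/-- The Mills ratio bound `e^{r²/2} ∫_{-∞}^r e^{-s²/2} ds < √(π/2)` for `r < 0`. -/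
lemma exp_mul_gaussianTail_lt {r : ℝ} (hr : r < 0) :
    exp (r ^ 2 / 2) * gaussianTail r < √(π / 2) := by
  have key : exp (r ^ 2 / 2) * gaussianTail r = ∫ s in Iic (0 : ℝ), exp (-(s ^ 2 / 2) - s * r) := by
    have h := (MeasureTheory.measurePreserving_add_right
      MeasureTheory.volume r).setIntegral_preimage_emb (measurableEmbedding_addRight r)
      (fun s ↦ exp (-(s ^ 2 / 2))) (Iic r)
    rw [gaussianTail, ← h, ← MeasureTheory.integral_const_mul]
    simp only [Set.preimage_add_const_Iic, sub_self, ← exp_add]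
    congr 1; ext s; congr 1; ring
  have hle : ∀ s ∈ Iic (0 : ℝ), exp (-(s ^ 2 / 2) - s * r) ≤ exp (-(s ^ 2 / 2)) := fun s hs ↦
    exp_le_exp.2 (by have := mul_nonneg_of_nonpos_of_nonpos hs hr.le; linarith)
  have hint : MeasureTheory.IntegrableOn (fun s : ℝ ↦ exp (-(s ^ 2 / 2) - s * r)) (Iic 0) :=
    integrable_exp_neg_half_sq.integrableOn.mono' (by fun_prop)
      ((MeasureTheory.ae_restrict_mem measurableSet_Iic).mono fun s hs ↦ by
        simpa [abs_of_pos (exp_pos _)] using hle s hs)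
  rw [key, ← gaussianTail_zero, gaussianTail, ← sub_pos,
    ← MeasureTheory.integral_sub integrable_exp_neg_half_sq.integrableOn hint,
    MeasureTheory.setIntegral_pos_iff_support_of_nonneg_ae
      ((MeasureTheory.ae_restrict_mem measurableSet_Iic).mono fun s hs ↦ sub_nonneg.2 (hle s hs))
      (integrable_exp_neg_half_sq.integrableOn.sub hint)]
  refine lt_of_lt_of_le (b := MeasureTheory.volume (Ioo (-1 : ℝ) 0)) (by simp)
    (MeasureTheory.measure_mono fun s hs ↦ ⟨?_, hs.2.le⟩)
  refine (sub_pos.2 (exp_lt_exp.2 ?_)).ne'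
  have := mul_pos_of_neg_of_neg hs.2 hr
  linarith

/-- A solution satisfies `R = r₀ e^{(r₁² - R'²)/2}`. -/
lemma IsCircleSol.eq_exp {r₀ r₁ : ℝ} {T : EReal} {R : ℝ → ℝ} (hr₀ : 0 < r₀)
    (h : IsCircleSol r₀ r₁ T R) {t : ℝ} (ht : 0 ≤ t) (htT : (t : EReal) < T) :
    R t = r₀ * exp (r₁ ^ 2 / 2) * exp (-(deriv R t ^ 2 / 2)) := by
  obtain ⟨h0, h1, hR⟩ := h
  have hd : ∀ s ∈ Icc 0 t, HasDerivAt (fun s ↦ log (R s) + deriv R s ^ 2 / 2) 0 s := by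
    intro s hs
    obtain ⟨hpos, hd1, hd2, heq⟩ := hR s hs.1 ((EReal.coe_le_coe_iff.2 hs.2).trans_lt htT)
    refine ((hd1.hasDerivAt.log hpos.ne').add ((hd2.hasDerivAt.pow 2).div_const 2)).congr_deriv ?_
    rw [heq]
    field_simp
    ring
  have hc := constant_of_has_deriv_right_zero
    (fun s hs ↦ (hd s hs).continuousAt.continuousWithinAt)
    (fun s hs ↦ (hd s (Ico_subset_Icc_self hs)).hasDerivWithinAt) t ⟨ht, le_rfl⟩
  simp only [h0, h1] at hc
  rw [← exp_log (hR t ht htT).1, eq_sub_of_add_eq hc, ← exp_log hr₀, ← exp_add, ← exp_add, log_exp]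
  ring_nf

/-- Along a solution, time is an affine function of the Gaussian tail of the velocity. -/
lemma IsCircleSol.mul_gaussianTail_deriv {r₀ r₁ : ℝ} {T : EReal} {R : ℝ → ℝ} (hr₀ : 0 < r₀)
    (h : IsCircleSol r₀ r₁ T R) {t : ℝ} (ht : 0 ≤ t) (htT : (t : EReal) < T) :
    r₀ * exp (r₁ ^ 2 / 2) * gaussianTail (deriv R t) =
      r₀ * exp (r₁ ^ 2 / 2) * gaussianTail r₁ - t := by
  have hd : ∀ s ∈ Icc 0 t, HasDerivAt
      (fun s ↦ r₀ * exp (r₁ ^ 2 / 2) * gaussianTail (deriv R s) + s) 0 s := by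
    intro s hs
    have hsT := (EReal.coe_le_coe_iff.2 hs.2).trans_lt htT
    obtain ⟨hpos, -, hd2, heq⟩ := h.2.2 s hs.1 hsT
    refine ((((hasStrictDerivAt_gaussianTail (deriv R s)).hasDerivAt.comp s
      hd2.hasDerivAt).const_mul (r₀ * exp (r₁ ^ 2 / 2))).add (hasDerivAt_id s)).congr_deriv ?_
    rw [← mul_assoc, ← h.eq_exp hr₀ hs.1 hsT, heq]
    field_simp
    ring
  have hc := constant_of_has_deriv_right_zero
    (fun s hs ↦ (hd s hs).continuousAt.continuousWithinAt)
    (fun s hs ↦ (hd s (Ico_subset_Icc_self hs)).hasDerivWithinAt) t ⟨ht, le_rfl⟩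
  simp only [h.2.1] at hc
  linarith

/-- The explicit solution, parametrised by its velocity. -/
lemma exists_isCircleSol {r₀ : ℝ} (r₁ : ℝ) (hr₀ : 0 < r₀) :
    ∃ R, IsCircleSol r₀ r₁ ((r₀ * exp (r₁ ^ 2 / 2) * gaussianTail r₁ : ℝ) : EReal) R := by
  set A := r₀ * exp (r₁ ^ 2 / 2) with hA
  have hApos : 0 < A := by positivity
  set Φ : ℝ → ℝ := fun p ↦ A * gaussianTail r₁ - A * gaussianTail p
  have hΦd (p : ℝ) : HasStrictDerivAt Φ (-(A * exp (-(p ^ 2 / 2)))) p :=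
    ((hasStrictDerivAt_gaussianTail p).const_mul A).const_sub _
  have hne (p : ℝ) : -(A * exp (-(p ^ 2 / 2))) ≠ 0 :=
    neg_ne_zero.2 (by positivity)
  have hinj : Function.Injective Φ := fun p q hpq ↦
    strictMono_gaussianTail.injective (mul_left_cancel₀ hApos.ne' (sub_right_injective hpq))
  set g := Function.invFun Φ
  have hgΦ (p : ℝ) : g (Φ p) = p := Function.leftInverse_invFun hinj p
  set R : ℝ → ℝ := fun t ↦ A * exp (-(g t ^ 2 / 2)) with hR
  have hgd (p : ℝ) : HasDerivAt g (-(A * exp (-(p ^ 2 / 2))))⁻¹ (Φ p) :=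
    ((hΦd p).to_local_left_inverse (hne p) (Eventually.of_forall hgΦ)).hasDerivAt
  have hRd (p : ℝ) : HasDerivAt R (g (Φ p)) (Φ p) := by
    refine (((((hgd p).pow 2).div_const 2).neg).exp.const_mul A).congr_deriv ?_
    simp only [Pi.neg_apply, hgΦ]
    field_simp
    norm_num [hgΦ]
    ring
  have hderiv (p : ℝ) : deriv R =ᶠ[𝓝 (Φ p)] g := by
    rw [← (hΦd p).map_nhds_eq (hne p)]
    exact eventually_map.2 (Eventually.of_forall fun q ↦ (hRd q).deriv)
  have h0 : Φ r₁ = 0 := sub_self _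
  refine ⟨R, ?_, ?_, fun t ht htL ↦ ?_⟩
  · rw [← h0, hR]
    simp only [hgΦ, hA, mul_assoc, ← exp_add]
    simp
  · rw [← h0, (hderiv r₁).eq_of_nhds, hgΦ]
  · rw [EReal.coe_lt_coe_iff] at htL
    have hlim : Tendsto Φ atBot (𝓝 (A * gaussianTail r₁)) := by
      simpa using (tendsto_gaussianTail_atBot.const_mul A).const_sub (A * gaussianTail r₁)
    obtain ⟨q, hq⟩ := (hlim.eventually (lt_mem_nhds htL)).exists
    obtain ⟨p, rfl⟩ := mem_range_of_exists_le_of_exists_ge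
      (continuous_iff_continuousAt.2 fun p ↦ (hΦd p).hasDerivAt.continuousAt)
      ⟨r₁, h0.trans_le ht⟩ ⟨q, hq.le⟩
    have hd2 := (hgd p).congr_of_eventuallyEq (hderiv p)
    refine ⟨by positivity, (hRd p).differentiableAt, hd2.differentiableAt, ?_⟩
    rw [hd2.deriv, hR]
    simp only [hgΦ, inv_neg, one_div]

/-- For the hyperbolic mean curvature flow of round circles, `R'' = −1/R`, `R(0) = r₀ > 0`,
`R'(0) = r₁ ≤ 0`: the maximal positive solution exists only on a finite interval `[0,T*)`,
`R` is nonincreasing (strictly decreasing on `(0,T*)`), `R(t) → 0` as `t → T*`, and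
`T* ≤ √(π/2)·r₀` with equality iff `r₁ = 0`. -/
theorem circle_shrinks_nonpositive_initial_velocity
    (r₀ r₁ : ℝ) (hr₀ : 0 < r₀) (hr₁ : r₁ ≤ 0)
    (Tstar : EReal) (hT : 0 < Tstar) (R : ℝ → ℝ)
    (hsol : IsCircleSol r₀ r₁ Tstar R)
    (hmax : ∀ T' : ℝ, Tstar < (T' : EReal) → ¬ ∃ R' : ℝ → ℝ, IsCircleSol r₀ r₁ (T' : EReal) R') :
    ∃ T : ℝ, Tstar = (T : EReal) ∧
      AntitoneOn R (Ico 0 T) ∧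
      StrictAntiOn R (Ioo 0 T) ∧
      Tendsto R (𝓝[<] T) (𝓝 0) ∧
      T ≤ Real.sqrt (π / 2) * r₀ ∧
      (T = Real.sqrt (π / 2) * r₀ ↔ r₁ = 0) := by
  set A := r₀ * exp (r₁ ^ 2 / 2) with hA
  have hApos : 0 < A := by positivity
  have htail {t : ℝ} (ht : 0 ≤ t) (htT : (t : EReal) < Tstar) :
      A * gaussianTail (deriv R t) = A * gaussianTail r₁ - t :=
    hsol.mul_gaussianTail_deriv hr₀ ht htT
  have hTeq : Tstar = ((A * gaussianTail r₁ : ℝ) : EReal) := by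
    refine le_antisymm (not_lt.1 fun hlt ↦ ?_)
      (not_lt.1 fun hlt ↦ hmax _ hlt (exists_isCircleSol r₁ hr₀))
    have := htail (mul_pos hApos (gaussianTail_pos r₁)).le hlt
    have := mul_pos hApos (gaussianTail_pos (deriv R (A * gaussianTail r₁)))
    linarith
  subst hTeq
  simp only [EReal.coe_lt_coe_iff] at htail
  have hexp {t : ℝ} (ht : 0 ≤ t) (htT : t < A * gaussianTail r₁) :
      R t = A * exp (-(deriv R t ^ 2 / 2)) :=
    hsol.eq_exp hr₀ ht (EReal.coe_lt_coe_iff.2 htT)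
  have hanti : StrictAntiOn R (Ico 0 (A * gaussianTail r₁)) := by
    intro s hs t ht hst
    have hs' := htail hs.1 hs.2
    have ht' := htail ht.1 ht.2
    have hlt : deriv R t < deriv R s :=
      strictMono_gaussianTail.lt_iff_lt.1 ((mul_lt_mul_iff_right₀ hApos).1 (by linarith))
    have hle : deriv R s ≤ r₁ :=
      strictMono_gaussianTail.le_iff_le.1 ((mul_le_mul_iff_right₀ hApos).1 (by linarith [hs.1]))
    rw [hexp hs.1 hs.2, hexp ht.1 ht.2]
    gcongr ?_ * exp ?_
    nlinarith
  have hderiv : Tendsto (deriv R) (𝓝[<] (A * gaussianTail r₁)) atBot := by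
    refine tendsto_atBot.2 fun M ↦ ?_
    have hpos := mul_pos hApos (gaussianTail_pos r₁)
    have hM := mul_pos hApos (gaussianTail_pos M)
    filter_upwards [Ioo_mem_nhdsLT (max_lt hpos (sub_lt_self _ hM))] with t ht
    have ht0 := (le_max_left _ _).trans ht.1.le
    have htM := (le_max_right _ _).trans ht.1.le
    have := htail ht0 ht.2
    exact strictMono_gaussianTail.le_iff_le.1 ((mul_le_mul_iff_right₀ hApos).1 (by linarith))
  have hlim : Tendsto R (𝓝[<] (A * gaussianTail r₁)) (𝓝 0) := by
    have hsq : Tendsto (fun p : ℝ ↦ p ^ 2 / 2) atBot atTop := by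
      simpa using ((tendsto_pow_atTop two_ne_zero).comp
        tendsto_abs_atBot_atTop).atTop_div_const (two_pos (α := ℝ))
    have h := ((tendsto_exp_neg_atTop_nhds_zero.comp (hsq.comp hderiv)).const_mul A)
    rw [mul_zero] at h
    refine h.congr' ?_
    filter_upwards [Ioo_mem_nhdsLT (mul_pos hApos (gaussianTail_pos r₁))] with t ht
    exact (hexp ht.1.le ht.2).symm
  have hzero (h : r₁ = 0) : A * gaussianTail r₁ = √(π / 2) * r₀ := by
    simp [hA, h, gaussianTail_zero, mul_comm]
  have hneg (h : r₁ < 0) : A * gaussianTail r₁ < √(π / 2) * r₀ := by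
    rw [hA, mul_assoc, mul_comm]
    exact mul_lt_mul_of_pos_right (exp_mul_gaussianTail_lt h) hr₀
  refine ⟨_, rfl, hanti.antitoneOn, hanti.mono Ioo_subset_Ico_self, hlim, ?_, ?_, hzero⟩
  · exact hr₁.lt_or_eq.elim (fun h ↦ (hneg h).le) fun h ↦ (hzero h).le
  · exact fun h ↦ hr₁.eq_of_not_lt fun h' ↦ (hneg h').ne h
end

section
/- Let S : ℝ × [0,T) → ℝ be a smooth function, 2π-periodic in θ, with S_θθ + S > 0, satisfying S_tt = ((S_θt)² − 1)·k where k = 1/(S_θθ + S). Then the curvature k satisfies the second-order hyperbolic equation k_tt = k²(1 − (S_θt)²) k_θθ + 2k S_θt k_θt + 4k² S_θt S_t k_θ − 4k S_t k_t + ((S_θt)² + 1 − 2(S_t)²) k³ on ℝ × [0,T). -/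
open Real Set Function

/-- The curvature `k = 1/(S_θθ + S)` of the convex curve with support function `S(·,t)`. -/
noncomputable def curv (S : ℝ → ℝ → ℝ) : ℝ → ℝ → ℝ :=
  fun θ t => 1 / (pdθ (pdθ S) θ t + S θ t)

/-- The angular partial derivative as a directional derivative. -/
theorem hasDerivAt_fderiv_angle {F : ℝ → ℝ → ℝ} (hF : ContDiff ℝ (⊤ : ℕ∞) (uncurry F)) (θ t : ℝ) :
    HasDerivAt (fun y => F y t) (fderiv ℝ (uncurry F) (θ, t) (1, 0)) θ := by
  have h := (hF.differentiable (by simp) (θ, t)).hasFDerivAt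
  exact h.comp_hasDerivAt (f := fun y : ℝ => (y, t)) θ
    ((hasDerivAt_id θ).prodMk (hasDerivAt_const θ t))

/-- The time partial derivative as a directional derivative. -/
theorem hasDerivAt_fderiv_time {F : ℝ → ℝ → ℝ} (hF : ContDiff ℝ (⊤ : ℕ∞) (uncurry F)) (θ t : ℝ) :
    HasDerivAt (fun s => F θ s) (fderiv ℝ (uncurry F) (θ, t) (0, 1)) t := by
  have h := (hF.differentiable (by simp) (θ, t)).hasFDerivAt
  exact h.comp_hasDerivAt (f := fun s : ℝ => (θ, s)) t
    ((hasDerivAt_const t θ).prodMk (hasDerivAt_id t))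

theorem hasDerivAt_pdθ {F : ℝ → ℝ → ℝ} (hF : ContDiff ℝ (⊤ : ℕ∞) (uncurry F)) (θ t : ℝ) :
    HasDerivAt (fun y => F y t) (pdθ F θ t) θ :=
  (hasDerivAt_fderiv_angle hF θ t).differentiableAt.hasDerivAt

theorem hasDerivAt_pdt {F : ℝ → ℝ → ℝ} (hF : ContDiff ℝ (⊤ : ℕ∞) (uncurry F)) (θ t : ℝ) :
    HasDerivAt (fun s => F θ s) (pdt F θ t) t :=
  (hasDerivAt_fderiv_time hF θ t).differentiableAt.hasDerivAt

theorem uncurry_pdθ {F : ℝ → ℝ → ℝ} (hF : ContDiff ℝ (⊤ : ℕ∞) (uncurry F)) :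
    uncurry (pdθ F) = fun p => fderiv ℝ (uncurry F) p (1, 0) :=
  funext fun p => (hasDerivAt_fderiv_angle hF p.1 p.2).deriv

theorem uncurry_pdt {F : ℝ → ℝ → ℝ} (hF : ContDiff ℝ (⊤ : ℕ∞) (uncurry F)) :
    uncurry (pdt F) = fun p => fderiv ℝ (uncurry F) p (0, 1) :=
  funext fun p => (hasDerivAt_fderiv_time hF p.1 p.2).deriv

theorem contDiff_pdθ {F : ℝ → ℝ → ℝ} (hF : ContDiff ℝ (⊤ : ℕ∞) (uncurry F)) :
    ContDiff ℝ (⊤ : ℕ∞) (uncurry (pdθ F)) := by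
  rw [uncurry_pdθ hF]
  exact (hF.fderiv_right (m := (⊤ : ℕ∞)) (by simp)).clm_apply contDiff_const

theorem contDiff_pdt {F : ℝ → ℝ → ℝ} (hF : ContDiff ℝ (⊤ : ℕ∞) (uncurry F)) :
    ContDiff ℝ (⊤ : ℕ∞) (uncurry (pdt F)) := by
  rw [uncurry_pdt hF]
  exact (hF.fderiv_right (m := (⊤ : ℕ∞)) (by simp)).clm_apply contDiff_const

/-- Mixed partial derivatives of a smooth function commute. -/
theorem pdt_pdθ_comm {F : ℝ → ℝ → ℝ} (hF : ContDiff ℝ (⊤ : ℕ∞) (uncurry F)) :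
    pdt (pdθ F) = pdθ (pdt F) := by
  funext θ t
  have hd : DifferentiableAt ℝ (fderiv ℝ (uncurry F)) (θ, t) :=
    (hF.fderiv_right (m := (⊤ : ℕ∞)) (by simp)).differentiable (by simp) _
  have h1 : pdt (pdθ F) θ t = _ := (hasDerivAt_fderiv_time (contDiff_pdθ hF) θ t).deriv
  have h2 : pdθ (pdt F) θ t = _ := (hasDerivAt_fderiv_angle (contDiff_pdt hF) θ t).deriv
  rw [h1, h2, uncurry_pdθ hF, uncurry_pdt hF,
    fderiv_clm_apply hd (differentiableAt_const _), fderiv_clm_apply hd (differentiableAt_const _)]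
  have hs : IsSymmSndFDerivAt ℝ (uncurry F) (θ, t) :=
    hF.contDiffAt.isSymmSndFDerivAt (by
      rw [minSmoothness_of_isRCLikeNormedField]
      exact WithTop.coe_le_coe.mpr le_top)
  simpa using hs.eq (0, 1) (1, 0)

/-- First and second derivatives of the reciprocal of a function. -/
theorem deriv_deriv_one_div {f f' : ℝ → ℝ} {f'' x : ℝ} (hx : f x ≠ 0)
    (hf : ∀ y, HasDerivAt f (f' y) y) (hf' : HasDerivAt f' f'' x) :
    deriv (fun y => deriv (fun z => 1 / f z) y) x
      = -f'' / f x ^ 2 + 2 * f' x ^ 2 / f x ^ 3 := by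
  have hev : (fun y => deriv (fun z => 1 / f z) y) =ᶠ[nhds x] fun y => -f' y / f y ^ 2 := by
    filter_upwards [(hf x).continuousAt.eventually_ne hx] with y hy
    simpa [one_div] using ((hf y).fun_inv hy).deriv
  rw [hev.deriv_eq, (hf'.fun_neg.fun_div ((hf x).fun_pow 2) (pow_ne_zero 2 hx)).deriv]
  field_simp
  push_cast
  ring

/-- Along the hyperbolic mean curvature flow `S_tt = ((S_θt)² − 1)·k`, the curvature
`k = 1/(S_θθ + S)` satisfies the second-order hyperbolic equation
`k_tt = k²(1 − S_θt²) k_θθ + 2k S_θt k_θt + 4k² S_θt S_t k_θ − 4k S_t k_t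
        + (S_θt² + 1 − 2S_t²) k³`. -/
theorem curvature_evolution_equation
    (T : ℝ) (S : ℝ → ℝ → ℝ)
    (hS : ContDiff ℝ (⊤ : ℕ∞) (uncurry S))
    (hper : ∀ θ t, S (θ + 2 * π) t = S θ t)
    (hconv : ∀ θ t, t ∈ Ico (0:ℝ) T → 0 < pdθ (pdθ S) θ t + S θ t)
    (hpde : ∀ θ t, t ∈ Ico (0:ℝ) T →
      pdt (pdt S) θ t = ((pdθ (pdt S) θ t) ^ 2 - 1) * curv S θ t) :
    ∀ θ t, t ∈ Ico (0:ℝ) T →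
      pdt (pdt (curv S)) θ t =
        (curv S θ t) ^ 2 * (1 - (pdθ (pdt S) θ t) ^ 2) * pdθ (pdθ (curv S)) θ t
        + 2 * curv S θ t * pdθ (pdt S) θ t * pdθ (pdt (curv S)) θ t
        + 4 * (curv S θ t) ^ 2 * pdθ (pdt S) θ t * pdt S θ t * pdθ (curv S) θ t
        - 4 * curv S θ t * pdt S θ t * pdt (curv S) θ t
        + ((pdθ (pdt S) θ t) ^ 2 + 1 - 2 * (pdt S θ t) ^ 2) * (curv S θ t) ^ 3 := by
  intro θ t ht
  set u : ℝ → ℝ → ℝ := fun y s => pdθ (pdθ S) y s + S y s with hu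
  have hθS := contDiff_pdθ hS
  have hθθS := contDiff_pdθ hθS
  have hp := contDiff_pdt hS
  have hw := contDiff_pdθ hp
  have hw' := contDiff_pdθ hw
  have hq := contDiff_pdt hp
  have hu_smooth : ContDiff ℝ (⊤ : ℕ∞) (uncurry u) := hθθS.add hS
  have hu_pos : ∀ y, 0 < u y t := fun y => hconv y t ht
  have hu_ne : ∀ y, u y t ≠ 0 := fun y => (hu_pos y).ne'
  have hu_t : pdt u = fun y s => pdθ (pdθ (pdt S)) y s + pdt S y s := by
    funext y s
    have h := ((hasDerivAt_pdt hθθS y s).fun_add (hasDerivAt_pdt hS y s)).deriv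
    rw [pdt_pdθ_comm hθS, pdt_pdθ_comm hS] at h
    exact h
  have hu_tt : pdt (pdt u) θ t = pdθ (pdθ (pdt (pdt S))) θ t + pdt (pdt S) θ t := by
    rw [hu_t]
    have h := ((hasDerivAt_pdt hw' θ t).fun_add (hasDerivAt_pdt hp θ t)).deriv
    rw [pdt_pdθ_comm hw, pdt_pdθ_comm hp] at h
    exact h
  have hu_tθ : pdθ (pdt u) θ t = pdθ (pdθ (pdθ (pdt S))) θ t + pdθ (pdt S) θ t := by
    rw [hu_t]
    exact ((hasDerivAt_pdθ hw' θ t).fun_add (hasDerivAt_pdθ hp θ t)).deriv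
  have hk : ∀ y s, curv S y s = 1 / u y s := fun _ _ => rfl
  have hk_θ : ∀ y, pdθ (curv S) y t = -pdθ u y t / u y t ^ 2 := fun y => by
    simpa [pdθ, hk, one_div] using ((hasDerivAt_pdθ hu_smooth y t).fun_inv (hu_ne y)).deriv
  have hk_t : ∀ y, pdt (curv S) y t = -pdt u y t / u y t ^ 2 := fun y => by
    simpa [pdt, hk, one_div] using ((hasDerivAt_pdt hu_smooth y t).fun_inv (hu_ne y)).deriv
  have hk_θθ : pdθ (pdθ (curv S)) θ t
      = -pdθ (pdθ u) θ t / u θ t ^ 2 + 2 * pdθ u θ t ^ 2 / u θ t ^ 3 :=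
    deriv_deriv_one_div (hu_ne θ) (fun y => hasDerivAt_pdθ hu_smooth y t)
      (hasDerivAt_pdθ (contDiff_pdθ hu_smooth) θ t)
  have hk_tt : pdt (pdt (curv S)) θ t
      = -pdt (pdt u) θ t / u θ t ^ 2 + 2 * pdt u θ t ^ 2 / u θ t ^ 3 :=
    deriv_deriv_one_div (hu_ne θ) (fun s => hasDerivAt_pdt hu_smooth θ s)
      (hasDerivAt_pdt (contDiff_pdt hu_smooth) θ t)
  have hk_tθ : pdθ (pdt (curv S)) θ t
      = -pdθ (pdt u) θ t / u θ t ^ 2 + 2 * pdt u θ t * pdθ u θ t / u θ t ^ 3 := by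
    have h := ((hasDerivAt_pdθ (contDiff_pdt hu_smooth) θ t).fun_neg.fun_div
      ((hasDerivAt_pdθ hu_smooth θ t).fun_pow 2) (pow_ne_zero 2 (hu_ne θ))).deriv
    rw [pdθ, funext hk_t, h]
    have := hu_ne θ
    field_simp
    push_cast
    ring
  have hq_θ : ∀ y, pdθ (pdt (pdt S)) y t
      = 2 * pdθ (pdt S) y t * pdθ (pdθ (pdt S)) y t / u y t
        - (pdθ (pdt S) y t ^ 2 - 1) * pdθ u y t / u y t ^ 2 := fun y => by
    have h := ((((hasDerivAt_pdθ hw y t).fun_pow 2).sub_const 1).fun_div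
      (hasDerivAt_pdθ hu_smooth y t) (hu_ne y)).deriv
    have he : (fun y => pdt (pdt S) y t) = fun y => (pdθ (pdt S) y t ^ 2 - 1) / u y t :=
      funext fun y => by rw [hpde y t ht, hk, mul_one_div]
    rw [pdθ, he, h]
    have := hu_ne y
    field_simp
    push_cast
    ring
  have hq_θθ : pdθ (pdθ (pdt (pdt S))) θ t
      = 2 * pdθ (pdθ (pdt S)) θ t ^ 2 / u θ t
        + 2 * pdθ (pdt S) θ t * pdθ (pdθ (pdθ (pdt S))) θ t / u θ t
        - 4 * pdθ (pdt S) θ t * pdθ (pdθ (pdt S)) θ t * pdθ u θ t / u θ t ^ 2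
        + (pdθ (pdt S) θ t ^ 2 - 1)
          * (-pdθ (pdθ u) θ t / u θ t ^ 2 + 2 * pdθ u θ t ^ 2 / u θ t ^ 3) := by
    have hU := hasDerivAt_pdθ hu_smooth θ t
    have hW := hasDerivAt_pdθ hw θ t
    have h := ((((hW.const_mul 2).fun_mul (hasDerivAt_pdθ hw' θ t)).fun_div hU (hu_ne θ)).fun_sub
      ((((hW.fun_pow 2).sub_const 1).fun_mul
        (hasDerivAt_pdθ (contDiff_pdθ hu_smooth) θ t)).fun_div
          (hU.fun_pow 2) (pow_ne_zero 2 (hu_ne θ)))).deriv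
    rw [pdθ, funext hq_θ, h]
    have := hu_ne θ
    field_simp
    push_cast
    ring
  have hu_t' : pdt u θ t = pdθ (pdθ (pdt S)) θ t + pdt S θ t := by rw [hu_t]
  rw [hk_tt, hk_tθ, hk_θθ, hk_θ, hk_t, hk, hu_tt, hu_tθ, hu_t', hq_θθ, hpde θ t ht, hk]
  have := hu_ne θ
  field_simp
  ring
end

section
/- Let S : ℝ × [0,T) → ℝ be a smooth function, 2π-periodic in θ, with S_θθ + S > 0, satisfying S_tt = ((S_θt)² − 1)·k where k = 1/(S_θθ + S), and let σ̃ = −S_t (the normal velocity). Then the arclength L(t) = ∫₀^{2π} (S_θθ(θ,t) + S(θ,t)) dθ of the evolving closed curve satisfies L'(t) = −∫₀^{2π} σ̃(θ,t) dθ and L''(t) = ∫₀^{2π} ( (σ̃_θ(θ,t))² k(θ,t) − k(θ,t) ) dθ for all t ∈ [0,T). -/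
open Real Set Function intervalIntegral

/-- The normal velocity `σ̃ = −S_t` of the flow. -/
noncomputable def normalVel (S : ℝ → ℝ → ℝ) : ℝ → ℝ → ℝ := fun θ t => -(pdt S θ t)

/-- The total length `L(t) = ∫₀^{2π} (S_θθ + S) dθ` of the evolving closed curve. -/
noncomputable def curveLength (S : ℝ → ℝ → ℝ) (t : ℝ) : ℝ :=
  ∫ θ in (0:ℝ)..(2 * π), (pdθ (pdθ S) θ t + S θ t)

theorem hasDerivAt_fst_of_contDiff {f : ℝ → ℝ → ℝ} (hf : ContDiff ℝ (⊤ : ℕ∞) (uncurry f))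
    (θ t : ℝ) : HasDerivAt (fun y => f y t) (fderiv ℝ (uncurry f) (θ, t) (1, 0)) θ := by
  have h := (hf.differentiable (by simp) (θ, t)).hasFDerivAt
  exact h.comp_hasDerivAt θ ((hasDerivAt_id θ).prodMk (hasDerivAt_const θ t))

theorem hasDerivAt_snd_of_contDiff {f : ℝ → ℝ → ℝ} (hf : ContDiff ℝ (⊤ : ℕ∞) (uncurry f))
    (θ t : ℝ) : HasDerivAt (fun s => f θ s) (fderiv ℝ (uncurry f) (θ, t) (0, 1)) t := by
  have h := (hf.differentiable (by simp) (θ, t)).hasFDerivAt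
  exact h.comp_hasDerivAt t ((hasDerivAt_const t θ).prodMk (hasDerivAt_id t))

theorem contDiff_pdθ_s6 {f : ℝ → ℝ → ℝ} (hf : ContDiff ℝ (⊤ : ℕ∞) (uncurry f)) :
    ContDiff ℝ (⊤ : ℕ∞) (uncurry (pdθ f)) := by
  have h : uncurry (pdθ f) = fun p => fderiv ℝ (uncurry f) p (1, 0) :=
    funext fun p => (hasDerivAt_fst_of_contDiff hf p.1 p.2).deriv
  rw [h]
  exact (hf.fderiv_right (by simp)).clm_apply contDiff_const

theorem contDiff_pdt_s6 {f : ℝ → ℝ → ℝ} (hf : ContDiff ℝ (⊤ : ℕ∞) (uncurry f)) :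
    ContDiff ℝ (⊤ : ℕ∞) (uncurry (pdt f)) := by
  have h : uncurry (pdt f) = fun p => fderiv ℝ (uncurry f) p (0, 1) :=
    funext fun p => (hasDerivAt_snd_of_contDiff hf p.1 p.2).deriv
  rw [h]
  exact (hf.fderiv_right (by simp)).clm_apply contDiff_const

theorem continuous_left_of_contDiff {f : ℝ → ℝ → ℝ} (hf : ContDiff ℝ (⊤ : ℕ∞) (uncurry f))
    (t : ℝ) : Continuous fun θ => f θ t :=
  hf.continuous.comp (continuous_id.prodMk continuous_const)

/-- Differentiation under the integral sign for a smooth integrand. -/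
theorem hasDerivAt_integral_pdt {f : ℝ → ℝ → ℝ} (hf : ContDiff ℝ (⊤ : ℕ∞) (uncurry f))
    (a b t : ℝ) :
    HasDerivAt (fun s => ∫ θ in a..b, f θ s) (∫ θ in a..b, pdt f θ t) t := by
  have hf' := contDiff_pdt_s6 hf
  obtain ⟨C, hC⟩ := (isCompact_uIcc.prod (isCompact_closedBall t 1)).exists_bound_of_continuousOn
    (s := uIcc a b ×ˢ Metric.closedBall t 1) hf'.continuous.continuousOn
  refine (intervalIntegral.hasDerivAt_integral_of_dominated_loc_of_deriv_le
    (F := fun s θ => f θ s) (F' := fun s θ => pdt f θ s) (bound := fun _ => C)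
    (Metric.closedBall_mem_nhds t one_pos)
    (.of_forall fun s => (continuous_left_of_contDiff hf s).aestronglyMeasurable)
    ((continuous_left_of_contDiff hf t).intervalIntegrable a b)
    (continuous_left_of_contDiff hf' t).aestronglyMeasurable
    (.of_forall fun θ hθ s hs => hC (θ, s) ⟨uIoc_subset_uIcc hθ, hs⟩)
    intervalIntegrable_const
    (.of_forall fun θ _ s _ => ?_)).2
  exact (hasDerivAt_snd_of_contDiff hf θ s).differentiableAt.hasDerivAt

theorem pdθ_add_period {f : ℝ → ℝ → ℝ} {c : ℝ} (hf : ∀ θ t, f (θ + c) t = f θ t) (θ t : ℝ) :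
    pdθ f (θ + c) t = pdθ f θ t := by
  simp only [pdθ]
  rw [← deriv_comp_add_const]
  simp only [hf]

/-- The length of a closed curve is the integral of its support function. -/
theorem curveLength_eq_integral {S : ℝ → ℝ → ℝ} (hS : ContDiff ℝ (⊤ : ℕ∞) (uncurry S))
    (hper : ∀ θ t, S (θ + 2 * π) t = S θ t) (t : ℝ) :
    curveLength S t = ∫ θ in (0:ℝ)..(2 * π), S θ t := by
  have hS₁ := contDiff_pdθ_s6 hS
  have hint := (continuous_left_of_contDiff (contDiff_pdθ_s6 hS₁) t).intervalIntegrable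
    (μ := MeasureTheory.volume) 0 (2 * π)
  have hzero : ∫ θ in (0:ℝ)..(2 * π), pdθ (pdθ S) θ t = 0 := by
    rw [integral_eq_sub_of_hasDerivAt (f := fun θ => pdθ S θ t) (f' := fun θ => pdθ (pdθ S) θ t)
      (fun θ _ => (hasDerivAt_fst_of_contDiff hS₁ θ t).differentiableAt.hasDerivAt) hint]
    have h := pdθ_add_period hper 0 t
    rw [zero_add] at h
    exact sub_eq_zero.mpr h
  rw [curveLength, integral_add hint
    ((continuous_left_of_contDiff hS t).intervalIntegrable 0 (2 * π)), hzero, zero_add]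

/-- Along the hyperbolic mean curvature flow `S_tt = ((S_θt)² − 1)·k`, the arclength
`L(t)` of the evolving closed curve satisfies `L'(t) = −∫₀^{2π} σ̃ dθ` and
`L''(t) = ∫₀^{2π} ((σ̃_θ)² k − k) dθ`, where `σ̃ = −S_t` is the normal velocity. -/
theorem length_evolution
    (T : ℝ) (S : ℝ → ℝ → ℝ)
    (hS : ContDiff ℝ (⊤ : ℕ∞) (uncurry S))
    (hper : ∀ θ t, S (θ + 2 * π) t = S θ t)
    (hconv : ∀ θ t, t ∈ Ico (0:ℝ) T → 0 < pdθ (pdθ S) θ t + S θ t)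
    (hpde : ∀ θ t, t ∈ Ico (0:ℝ) T →
      pdt (pdt S) θ t = ((pdθ (pdt S) θ t) ^ 2 - 1) * curv S θ t) :
    ∀ t ∈ Ico (0:ℝ) T,
      deriv (curveLength S) t = -∫ θ in (0:ℝ)..(2 * π), normalVel S θ t ∧
      deriv (deriv (curveLength S)) t =
        ∫ θ in (0:ℝ)..(2 * π),
          ((pdθ (normalVel S) θ t) ^ 2 * curv S θ t - curv S θ t) := by
  intro t ht
  have hL : curveLength S = fun t => ∫ θ in (0:ℝ)..(2 * π), S θ t :=
    funext (curveLength_eq_integral hS hper)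
  have hL' : deriv (curveLength S) = fun t => ∫ θ in (0:ℝ)..(2 * π), pdt S θ t := by
    rw [hL]
    exact funext fun s => (hasDerivAt_integral_pdt hS 0 (2 * π) s).deriv
  constructor
  · simp only [hL', normalVel, integral_neg, neg_neg]
  · rw [hL', (hasDerivAt_integral_pdt (contDiff_pdt_s6 hS) 0 (2 * π) t).deriv]
    refine integral_congr fun θ _ => ?_
    have hσ : pdθ (normalVel S) θ t = -pdθ (pdt S) θ t := deriv.fun_neg
    simp only [hpde θ t ht, hσ]
    ring
end
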